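/- arXiv:1112.3304 — 3 statements merged into one kernel-verified Lean document; each statement's English description precedes it below -/
import Mathlib

section
/- Let m, n ≥ 2 and k ≥ 1 be integers. If there exist avoidance couplings of k walkers on the (loopless) complete graph K_m and of k walkers on the (loopless) complete graph K_n, then there exists an avoidance coupling of k walkers on K_{m+n}; moreover, if the two given couplings are Markovian, then the resulting coupling can be taken to be Markovian. -/
open MeasureTheory ProbabilityTheory

/-- `X` is a faithful simple random walk on the loopless complete graph `K_n`:
at each step the walker moves to a uniformly random vertex other than its
current one. -/
def IsWalkLoopless {Ω : Type} [MeasurableSpace Ω] (μ : Measure Ω) {n : ℕ}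
    (X : ℕ → Ω → Fin n) : Prop :=
  ∀ (t : ℕ) (v : ℕ → Fin n),
    μ {ω | ∀ s ≤ t + 1, X s ω = v s} =
      μ {ω | ∀ s ≤ t, X s ω = v s} *
        (if v (t + 1) = v t then 0 else ((n - 1 : ℕ) : ENNReal)⁻¹)

/-- `X` is a faithful simple random walk on the looped complete graph `K_n^*`:
at each step the walker moves to a uniformly random vertex (possibly its
current one). -/
def IsWalkLooped {Ω : Type} [MeasurableSpace Ω] (μ : Measure Ω) {n : ℕ}
    (X : ℕ → Ω → Fin n) : Prop :=
  ∀ (t : ℕ) (v : ℕ → Fin n),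
    μ {ω | ∀ s ≤ t + 1, X s ω = v s} =
      μ {ω | ∀ s ≤ t, X s ω = v s} * ((n : ℕ) : ENNReal)⁻¹

/-- The `k` walkers `X 0, …, X (k-1)`, moving in turn in cyclic order, almost
surely never collide: initially their positions are pairwise distinct, and
whenever a walker moves it never lands on the current position of another
walker (walkers `i < j` having already made their move number `t+1`, walkers
`i > j` still sitting at their position at time `t`). -/
def AvoidsAE {Ω : Type} [MeasurableSpace Ω] (μ : Measure Ω) {n k : ℕ}
    (X : Fin k → ℕ → Ω → Fin n) : Prop :=
  ∀ᵐ ω ∂μ,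
    (∀ i j : Fin k, i ≠ j → X i 0 ω ≠ X j 0 ω) ∧
    (∀ (t : ℕ) (i j : Fin k),
      (i < j → X j (t + 1) ω ≠ X i (t + 1) ω) ∧
      (j < i → X j (t + 1) ω ≠ X i t ω))

/-- The coupling is Markovian: there are transition rules `f j` so that for
every walker `j` and time `t`, conditionally on the whole history (all
positions up to time `t`, together with the moves at time `t+1` of the walkers
`i < j` preceding `j` in the current round), the next position `X j (t+1)` is
distributed according to `f j` applied to the current configuration. -/
def IsMarkovianCoupling {Ω : Type} [MeasurableSpace Ω] (μ : Measure Ω) {n k : ℕ}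
    (X : Fin k → ℕ → Ω → Fin n) : Prop :=
  ∃ f : Fin k → (Fin k → Fin n) → PMF (Fin n),
    ∀ (t : ℕ) (j : Fin k) (v : Fin k → ℕ → Fin n) (w : Fin n),
      μ {ω | ((∀ i : Fin k, ∀ s ≤ t, X i s ω = v i s) ∧
              (∀ i < j, X i (t + 1) ω = v i (t + 1))) ∧ X j (t + 1) ω = w} =
        μ {ω | (∀ i : Fin k, ∀ s ≤ t, X i s ω = v i s) ∧
               (∀ i < j, X i (t + 1) ω = v i (t + 1))} *
          f j (fun i => if i < j then v i (t + 1) else v i t) w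

/-- There is an avoidance coupling of `k` walkers on the loopless complete
graph `K_n`. -/
def AvoidanceCouplingLoopless (n k : ℕ) : Prop :=
  ∃ (Ω : Type) (_ : MeasurableSpace Ω) (μ : Measure Ω)
    (X : Fin k → ℕ → Ω → Fin n),
      IsProbabilityMeasure μ ∧ (∀ j t, Measurable (X j t)) ∧
      (∀ j, IsWalkLoopless μ (X j)) ∧ AvoidsAE μ X

/-- There is an avoidance coupling of `k` walkers on the looped complete
graph `K_n^*`. -/
def AvoidanceCouplingLooped (n k : ℕ) : Prop :=
  ∃ (Ω : Type) (_ : MeasurableSpace Ω) (μ : Measure Ω)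
    (X : Fin k → ℕ → Ω → Fin n),
      IsProbabilityMeasure μ ∧ (∀ j t, Measurable (X j t)) ∧
      (∀ j, IsWalkLooped μ (X j)) ∧ AvoidsAE μ X

/-- There is a Markovian avoidance coupling of `k` walkers on `K_n`. -/
def MarkovianAvoidanceCouplingLoopless (n k : ℕ) : Prop :=
  ∃ (Ω : Type) (_ : MeasurableSpace Ω) (μ : Measure Ω)
    (X : Fin k → ℕ → Ω → Fin n),
      IsProbabilityMeasure μ ∧ (∀ j t, Measurable (X j t)) ∧
      (∀ j, IsWalkLoopless μ (X j)) ∧ AvoidsAE μ X ∧ IsMarkovianCoupling μ X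

/-- There is a Markovian avoidance coupling of `k` walkers on `K_n^*`. -/
def MarkovianAvoidanceCouplingLooped (n k : ℕ) : Prop :=
  ∃ (Ω : Type) (_ : MeasurableSpace Ω) (μ : Measure Ω)
    (X : Fin k → ℕ → Ω → Fin n),
      IsProbabilityMeasure μ ∧ (∀ j t, Measurable (X j t)) ∧
      (∀ j, IsWalkLooped μ (X j)) ∧ AvoidsAE μ X ∧ IsMarkovianCoupling μ X

namespace ACSum

set_option linter.unusedSectionVars false

/-- vertices of the disjoint union -/
abbrev V (N : Bool → ℕ) := Σ b : Bool, Fin (N b)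

/-- one block of randomness: coins and one copy of each coupling -/
abbrev E (Ω : Bool → Type) := (Bool → Bool) × (∀ b, Ω b)

variable {N : Bool → ℕ} {k : ℕ} {Ω : Bool → Type}

/-- current side and last switching time -/
def st (ω : ℕ → E Ω) : ℕ → Bool × ℕ
  | 0 => (true, 0)
  | t + 1 => ((ω (t+1)).1 (st ω t).1,
      if (ω (t+1)).1 (st ω t).1 = (st ω t).1 then (st ω t).2 else t + 1)

/-- the combined walkers -/
def W (Y : ∀ b, Fin k → ℕ → Ω b → Fin (N b)) (j : Fin k) (t : ℕ) (ω : ℕ → E Ω) : V N :=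
  ⟨(st ω t).1, Y (st ω t).1 j (t - (st ω t).2) ((ω (st ω t).2).2 (st ω t).1)⟩

/-- last switching time of a deterministic side sequence -/
def lsw (σ : ℕ → Bool) : ℕ → ℕ
  | 0 => 0
  | t + 1 => if σ (t+1) = σ t then lsw σ t else t + 1

lemma lsw_le (σ : ℕ → Bool) (t : ℕ) : lsw σ t ≤ t := by
  induction t with
  | zero => simp [lsw]
  | succ t ih => simp only [lsw]; split_ifs <;> omega

lemma st_le (ω : ℕ → E Ω) (t : ℕ) : (st ω t).2 ≤ t := by
  induction t with
  | zero => simp [st]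
  | succ t ih => simp only [st]; split_ifs <;> omega

lemma lsw_const (σ : ℕ → Bool) (t : ℕ) :
    ∀ s, lsw σ t ≤ s → s ≤ t → lsw σ s = lsw σ t ∧ σ s = σ t := by
  induction t with
  | zero => intro s _ h; obtain rfl : s = 0 := by omega
            simp
  | succ t ih =>
    intro s h1 h2
    rcases Nat.lt_or_ge t s with h | h
    · obtain rfl : s = t + 1 := by omega
      simp
    · by_cases h3 : σ (t+1) = σ t
      · have : lsw σ (t+1) = lsw σ t := by simp [lsw, h3]
        rw [this] at h1 ⊢
        rw [h3]
        exact ih s h1 h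
      · simp only [lsw, h3, if_false] at h1
        omega

lemma st_lsw (σ : ℕ → Bool) (ω : ℕ → E Ω) (t : ℕ) (h : ∀ s ≤ t, (st ω s).1 = σ s) :
    (st ω t).2 = lsw σ t := by
  induction t with
  | zero => simp [st, lsw]
  | succ t ih =>
    have h1 := h (t+1) le_rfl
    have h2 := h t (by omega)
    simp only [st] at h1
    simp only [st, lsw, h2]
    rw [h2] at h1
    rw [h1, ih (fun s hs => h s (by omega))]

/-- coin condition -/
def CC (σ : ℕ → Bool) (i : ℕ) : Set (Bool → Bool) :=
  {c | if i = 0 then σ 0 = true else c (σ (i-1)) = σ i}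

lemma st_iff (σ : ℕ → Bool) (ω : ℕ → E Ω) (t : ℕ) :
    (∀ s ≤ t, (st ω s).1 = σ s) ↔ ∀ i ≤ t, (ω i).1 ∈ CC σ i := by
  induction t with
  | zero => simp [st, CC]
  | succ t ih =>
    have e1 : ∀ P : ℕ → Prop, (∀ s ≤ t+1, P s) ↔ ((∀ s ≤ t, P s) ∧ P (t+1)) := by
      intro P
      constructor
      · intro h; exact ⟨fun s hs => h s (by omega), h _ le_rfl⟩
      · rintro ⟨h1, h2⟩ s hs
        rcases Nat.lt_or_ge t s with h | h
        · obtain rfl : s = t + 1 := by omega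
          exact h2
        · exact h1 s h
    rw [e1, e1, ← ih]
    apply and_congr_right
    intro h
    simp [st, CC, h t le_rfl]

/-- the history event -/
def ev (Y : ∀ b, Fin k → ℕ → Ω b → Fin (N b)) (σ : ℕ → Bool)
    (A : ℕ → Set (Fin k → V N)) (t : ℕ) : Set (ℕ → E Ω) :=
  {ω | ∀ s ≤ t, (st ω s).1 = σ s ∧ (fun j => W Y j s ω) ∈ A s}

/-- the block event -/
def BB (Y : ∀ b, Fin k → ℕ → Ω b → Fin (N b)) (σ : ℕ → Bool)
    (A : ℕ → Set (Fin k → V N)) (t i : ℕ) : Set (E Ω) :=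
  {x | x.1 ∈ CC σ i ∧ ∀ s ≤ t, lsw σ s = i →
    (fun j => (⟨σ s, Y (σ s) j (s - i) (x.2 (σ s))⟩ : V N)) ∈ A s}

lemma W_eq (Y : ∀ b, Fin k → ℕ → Ω b → Fin (N b)) {t L : ℕ} {b : Bool} {ω : ℕ → E Ω}
    (h : st ω t = (b, L)) (j : Fin k) : W Y j t ω = ⟨b, Y b j (t - L) ((ω L).2 b)⟩ := by
  unfold W
  rw [h]

lemma lift_congr (Y : ∀ b, Fin k → ℕ → Ω b → Fin (N b)) {b b' : Bool} (h : b = b') (r : ℕ)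
    (x : ∀ b, Ω b) : (fun j => (⟨b, Y b j r (x b)⟩ : V N)) = fun j => ⟨b', Y b' j r (x b')⟩ := by
  subst h; rfl

lemma ev_eq (Y : ∀ b, Fin k → ℕ → Ω b → Fin (N b)) (σ : ℕ → Bool)
    (A : ℕ → Set (Fin k → V N)) (t : ℕ) :
    ev Y σ A t = {ω | ∀ i ≤ t, ω i ∈ BB Y σ A t i} := by
  ext ω
  simp only [ev, BB, Set.mem_ofPred_eq]
  constructor
  · intro h
    have h1 := fun s hs => (h s hs).1
    intro i hi
    refine ⟨(st_iff σ ω t).1 h1 i hi, fun s hs hL => ?_⟩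
    have := (h s hs).2
    have e : st ω s = (σ s, i) :=
      Prod.ext (h1 s hs) ((st_lsw σ ω s fun r hr => h1 r (hr.trans hs)).trans hL)
    simpa only [W_eq Y e] using this
  · intro h
    have h1 := (st_iff σ ω t).2 (fun i hi => (h i hi).1)
    intro s hs
    refine ⟨h1 s hs, ?_⟩
    have e : st ω s = (σ s, lsw σ s) :=
      Prod.ext (h1 s hs) ((st_lsw σ ω s fun r hr => h1 r (hr.trans hs)))
    simpa only [W_eq Y e] using (h (lsw σ s) ((lsw_le σ s).trans hs)).2 s hs rfl

/-- the history event for a single piece -/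
def SS (Y : ∀ b, Fin k → ℕ → Ω b → Fin (N b)) (b : Bool) (L r : ℕ)
    (A : ℕ → Set (Fin k → V N)) : Set (Ω b) :=
  {y | ∀ s ≤ r, (fun j => (⟨b, Y b j s y⟩ : V N)) ∈ A (L + s)}

lemma BB_lsw (Y : ∀ b, Fin k → ℕ → Ω b → Fin (N b)) (σ : ℕ → Bool)
    (A : ℕ → Set (Fin k → V N)) (t : ℕ) :
    BB Y σ A t (lsw σ t) = CC σ (lsw σ t) ×ˢ
      ((fun y : ∀ b, Ω b => y (σ t)) ⁻¹' SS Y (σ t) (lsw σ t) (t - lsw σ t) A) := by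
  ext x
  simp only [BB, SS, Set.mem_ofPred_eq, Set.mem_prod, Set.mem_preimage]
  refine and_congr_right fun _ => ?_
  have hl := lsw_le σ t
  constructor
  · intro h r hr
    have h1 := lsw_const σ t (lsw σ t + r) (by omega) (by omega)
    have := h (lsw σ t + r) (by omega) h1.1
    rw [lift_congr Y h1.2] at this
    simpa only [Nat.add_sub_cancel_left] using this
  · intro h s hs hL
    have hs' := lsw_le σ s
    have h1 := lsw_const σ t s (by omega) (by omega)
    have := h (s - lsw σ t) (by omega)
    rw [lift_congr Y h1.2]
    simpa only [Nat.add_sub_cancel' (show lsw σ t ≤ s by omega)] using this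

section meas
variable [∀ b, MeasurableSpace (Ω b)]

lemma meas_piece (Y : ∀ b, Fin k → ℕ → Ω b → Fin (N b)) (hY : ∀ b j t, Measurable (Y b j t))
    (b : Bool) (s : ℕ) (A : Set (Fin k → V N)) :
    MeasurableSet {y : Ω b | (fun j => (⟨b, Y b j s y⟩ : V N)) ∈ A} := by
  have : Measurable (fun y j => Y b j s y) := measurable_pi_iff.2 fun j => hY b j s
  exact this (Set.toFinite {c : Fin k → Fin (N b) | (fun j => (⟨b, c j⟩ : V N)) ∈ A}).measurableSet

lemma meas_SS (Y : ∀ b, Fin k → ℕ → Ω b → Fin (N b)) (hY : ∀ b j t, Measurable (Y b j t))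
    (b : Bool) (L r : ℕ) (A : ℕ → Set (Fin k → V N)) : MeasurableSet (SS Y b L r A) := by
  have : SS Y b L r A = ⋂ s, ⋂ (_ : s ≤ r),
    {y : Ω b | (fun j => (⟨b, Y b j s y⟩ : V N)) ∈ A (L + s)} := by
    ext; simp [SS]
  rw [this]
  exact MeasurableSet.iInter fun s => MeasurableSet.iInter fun _ => meas_piece Y hY b s _

lemma meas_BB (Y : ∀ b, Fin k → ℕ → Ω b → Fin (N b)) (hY : ∀ b j t, Measurable (Y b j t))
    (σ : ℕ → Bool) (A : ℕ → Set (Fin k → V N)) (t i : ℕ) : MeasurableSet (BB Y σ A t i) := by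
  have : BB Y σ A t i = (Prod.fst ⁻¹' CC σ i) ∩ ⋂ s, ⋂ (_ : s ≤ t), ⋂ (_ : lsw σ s = i),
     (fun x : E Ω => x.2 (σ s)) ⁻¹'
      {y : Ω (σ s) | (fun j => (⟨σ s, Y (σ s) j (s - i) y⟩ : V N)) ∈ A s} := by
    ext; simp [BB]
  rw [this]
  refine (measurable_fst (Set.toFinite _).measurableSet).inter ?_
  refine MeasurableSet.iInter fun s => MeasurableSet.iInter fun _ => MeasurableSet.iInter fun _ => ?_
  exact ((measurable_pi_apply _).comp measurable_snd) (meas_piece Y hY _ _ _)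

variable (coin : Bool → Measure Bool) (μ : ∀ b, Measure (Ω b))

/-- block law -/
noncomputable def ν : Measure (E Ω) := (Measure.pi coin).prod (Measure.pi μ)

variable [∀ b, IsProbabilityMeasure (coin b)] [∀ b, IsProbabilityMeasure (μ b)]

instance : IsProbabilityMeasure (ν coin μ) := by unfold ν; infer_instance

/-- full law -/
noncomputable def PP : Measure (ℕ → E Ω) := Measure.infinitePi (fun _ => ν coin μ)

instance : IsProbabilityMeasure (PP coin μ) := by unfold PP; infer_instance

lemma PP_cyl (t : ℕ) (B : ℕ → Set (E Ω)) (hB : ∀ i, MeasurableSet (B i)) :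
    PP coin μ {ω | ∀ i ≤ t, ω i ∈ B i} = ∏ i ∈ Finset.range (t+1), ν coin μ (B i) := by
  rw [← Measure.infinitePi_pi (fun _ => ν coin μ) (fun i _ => hB i)]
  unfold PP
  congr 1
  ext ω
  simp [Set.mem_pi]

lemma ν_prod (C : Set (Bool → Bool)) (b : Bool) (S : Set (Ω b)) (hS : MeasurableSet S) :
    ν coin μ (C ×ˢ ((fun y : ∀ b, Ω b => y b) ⁻¹' S)) = Measure.pi coin C * μ b S := by
  rw [ν, Measure.prod_prod, (measurePreserving_eval μ b).measure_preimage hS.nullMeasurableSet]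

lemma coin_eval (b b' : Bool) : Measure.pi coin {c | c b = b'} = coin b {b'} := by
  rw [← (measurePreserving_eval coin b).measure_preimage
    (measurableSet_singleton b').nullMeasurableSet]
  rfl

theorem key (Y : ∀ b, Fin k → ℕ → Ω b → Fin (N b)) (hY : ∀ b j t, Measurable (Y b j t))
    (σ : ℕ → Bool) (A : ℕ → Set (Fin k → V N)) (t : ℕ) :
    ∃ R : ENNReal,
      PP coin μ (ev Y σ A t) = R * μ (σ t) (SS Y (σ t) (lsw σ t) (t - lsw σ t) A) ∧
      (∀ A' : Set (Fin k → V N),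
        PP coin μ {ω | ω ∈ ev Y σ A t ∧ (st ω (t+1)).1 = σ t ∧ (fun j => W Y j (t+1) ω) ∈ A'} =
          R * coin (σ t) {σ t} * μ (σ t) {y | y ∈ SS Y (σ t) (lsw σ t) (t - lsw σ t) A ∧
            (fun j => (⟨σ t, Y (σ t) j (t - lsw σ t + 1) y⟩ : V N)) ∈ A'}) ∧
      (∀ (A' : Set (Fin k → V N)) (b' : Bool), b' ≠ σ t →
        PP coin μ {ω | ω ∈ ev Y σ A t ∧ (st ω (t+1)).1 = b' ∧ (fun j => W Y j (t+1) ω) ∈ A'} =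
          PP coin μ (ev Y σ A t) * (coin (σ t) {b'} *
            μ b' {y | (fun j => (⟨b', Y b' j 0 y⟩ : V N)) ∈ A'})) := by
  set L := lsw σ t with hL
  have hLt : L ≤ t := lsw_le σ t
  have hmem : L ∈ Finset.range (t+1) := by simp; omega
  have hst : ∀ ω ∈ ev Y σ A t, st ω t = (σ t, L) := fun ω h =>
    Prod.ext (h t le_rfl).1 (st_lsw σ ω t fun s hs => (h s hs).1)
  refine ⟨Measure.pi coin (CC σ L) * ∏ i ∈ (Finset.range (t+1)).erase L,
    ν coin μ (BB Y σ A t i), ?_, ?_, ?_⟩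
  · rw [ev_eq, PP_cyl coin μ t _ (meas_BB Y hY σ A t), ← Finset.mul_prod_erase _ _ hmem, hL,
      BB_lsw, ν_prod _ _ _ _ _ (meas_SS Y hY _ _ _ _)]
    ring
  · intro A'
    set S' : Set (Ω (σ t)) := {y | y ∈ SS Y (σ t) L (t - L) A ∧
            (fun j => (⟨σ t, Y (σ t) j (t - L + 1) y⟩ : V N)) ∈ A'} with hS'
    have mS' : MeasurableSet S' := (meas_SS Y hY _ _ _ _).inter (meas_piece Y hY _ _ _)
    let B : ℕ → Set (E Ω) := fun i => if i = t + 1 then {c : Bool → Bool | c (σ t) = σ t} ×ˢ Set.univ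
      else if i = L then CC σ L ×ˢ ((fun y : ∀ b, Ω b => y (σ t)) ⁻¹' S') else BB Y σ A t i
    have mB : ∀ i, MeasurableSet (B i) := by
      intro i
      simp only [B]
      split_ifs
      · exact (Set.toFinite _).measurableSet.prod MeasurableSet.univ
      · exact (Set.toFinite _).measurableSet.prod (measurable_pi_apply _ mS')
      · exact meas_BB Y hY σ A t i
    have hev : {ω | ω ∈ ev Y σ A t ∧ (st ω (t+1)).1 = σ t ∧ (fun j => W Y j (t+1) ω) ∈ A'} =
        {ω | ∀ i ≤ t+1, ω i ∈ B i} := by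
      ext ω
      simp only [Set.mem_ofPred_eq]
      have aux : ω ∈ ev Y σ A t → (st ω (t+1)).1 = σ t → ((fun j => W Y j (t+1) ω) ∈ A' ↔
          (fun j => (⟨σ t, Y (σ t) j (t - L + 1) ((ω L).2 (σ t))⟩ : V N)) ∈ A') := by
        intro h h1
        have h2 := hst ω h
        have h3 : st ω (t+1) = (σ t, L) := by
          simp only [st, h2] at h1 ⊢
          simp [h1]
        simp only [W_eq Y h3, show t + 1 - L = t - L + 1 by omega]
      constructor
      · rintro ⟨h, h1, h2⟩ i hi
        have h' := h
        rw [ev_eq] at h'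
        rw [aux h h1] at h2
        have h4 := hst ω h
        by_cases e1 : i = t + 1
        · subst e1
          simp only [st, h4] at h1
          simp [B, h1]
        · by_cases e2 : i = L
          · subst e2
            have := h' L hLt
            rw [BB_lsw] at this
            simp only [B, if_neg e1, if_true]
            exact ⟨this.1, this.2, h2⟩
          · simp only [B, if_neg e1, if_neg e2]
            exact h' i (by omega)
      · intro h
        have hLB := h L (by omega)
        simp only [B, if_neg (show L ≠ t+1 by omega), if_true] at hLB
        have h0 : ω ∈ ev Y σ A t := by
          rw [ev_eq]
          intro i hi
          have := h i (by omega)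
          simp only [B, if_neg (show i ≠ t+1 by omega)] at this
          split_ifs at this with e
          · rw [e] at this ⊢
            rw [BB_lsw]
            exact ⟨this.1, this.2.1⟩
          · exact this
        have h1 : (st ω (t+1)).1 = σ t := by
          have := h (t+1) le_rfl
          simp only [st, hst ω h0]
          simpa [B] using this
        exact ⟨h0, h1, (aux h0 h1).2 hLB.2.2⟩
    rw [hev, PP_cyl coin μ _ _ mB, Finset.prod_range_succ, ← Finset.mul_prod_erase _ _ hmem]
    have e1 : ν coin μ (B (t+1)) = coin (σ t) {σ t} := by
      simp only [B, if_true]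
      rw [ν, Measure.prod_prod, coin_eval]
      simp
    have e2 : ν coin μ (B L) = Measure.pi coin (CC σ L) * μ (σ t) S' := by
      simp only [B, if_neg (show L ≠ t+1 by omega), if_true]
      rw [ν_prod _ _ _ _ _ mS']
    have e3 : ∏ i ∈ (Finset.range (t+1)).erase L, ν coin μ (B i) =
        ∏ i ∈ (Finset.range (t+1)).erase L, ν coin μ (BB Y σ A t i) := by
      refine Finset.prod_congr rfl fun i hi => ?_
      simp only [Finset.mem_erase, Finset.mem_range] at hi
      simp only [B, if_neg (show i ≠ t+1 by omega), if_neg hi.1]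
    rw [e1, e2, e3]
    ring
  · intro A' b' hb'
    set S' : Set (Ω b') := {y | (fun j => (⟨b', Y b' j 0 y⟩ : V N)) ∈ A'} with hS'
    have mS' : MeasurableSet S' := meas_piece Y hY _ _ _
    let B : ℕ → Set (E Ω) := fun i => if i = t + 1 then
        {c : Bool → Bool | c (σ t) = b'} ×ˢ ((fun y : ∀ b, Ω b => y b') ⁻¹' S')
      else BB Y σ A t i
    have mB : ∀ i, MeasurableSet (B i) := by
      intro i
      simp only [B]
      split_ifs
      · exact (Set.toFinite _).measurableSet.prod (measurable_pi_apply _ mS')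
      · exact meas_BB Y hY σ A t i
    have hev : {ω | ω ∈ ev Y σ A t ∧ (st ω (t+1)).1 = b' ∧ (fun j => W Y j (t+1) ω) ∈ A'} =
        {ω | ∀ i ≤ t+1, ω i ∈ B i} := by
      ext ω
      simp only [Set.mem_ofPred_eq]
      have aux : ω ∈ ev Y σ A t → (st ω (t+1)).1 = b' → ((fun j => W Y j (t+1) ω) ∈ A' ↔
          (ω (t+1)).2 b' ∈ S') := by
        intro h h1
        have h2 := hst ω h
        have h3 : st ω (t+1) = (b', t+1) := by
          simp only [st, h2] at h1 ⊢
          simp [h1, hb']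
        simp only [W_eq Y h3, Nat.sub_self, hS', Set.mem_ofPred_eq]
      constructor
      · rintro ⟨h, h1, h2⟩ i hi
        have h' := h
        rw [ev_eq] at h'
        rw [aux h h1] at h2
        have h4 := hst ω h
        by_cases e1 : i = t + 1
        · subst e1
          simp only [st, h4] at h1
          simp only [B, if_true]
          exact ⟨h1, h2⟩
        · simp only [B, if_neg e1]
          exact h' i (by omega)
      · intro h
        have h0 : ω ∈ ev Y σ A t := by
          rw [ev_eq]
          intro i hi
          have := h i (by omega)
          simpa only [B, if_neg (show i ≠ t+1 by omega)] using this
        have := h (t+1) le_rfl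
        simp only [B, if_true] at this
        have h1 : (st ω (t+1)).1 = b' := by
          simp only [st, hst ω h0]
          exact this.1
        exact ⟨h0, h1, (aux h0 h1).2 this.2⟩
    rw [hev, PP_cyl coin μ _ _ mB, Finset.prod_range_succ, ev_eq,
      PP_cyl coin μ t _ (meas_BB Y hY σ A t)]
    have e1 : ν coin μ (B (t+1)) = coin (σ t) {b'} * μ b' S' := by
      simp only [B, if_true]
      rw [ν_prod _ _ _ _ _ mS', coin_eval]
    rw [e1]
    congr 1
    refine Finset.prod_congr rfl fun i hi => ?_
    simp only [Finset.mem_range] at hi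
    simp only [B, if_neg (show i ≠ t+1 by omega)]

/-- projection of a vertex to side `b` -/
def pull (hN : ∀ b, 2 ≤ N b) (b : Bool) (z : V N) : Fin (N b) :=
  if h : z.1 = b then h ▸ z.2 else ⟨0, by have := hN b; omega⟩

lemma mk_eq_iff (hN : ∀ b, 2 ≤ N b) {b : Bool} {z : V N} (h : z.1 = b) (x : Fin (N b)) :
    (⟨b, x⟩ : V N) = z ↔ x = pull hN b z := by
  obtain ⟨b', z⟩ := z
  subst h
  simp [pull]

lemma pull_inj (hN : ∀ b, 2 ≤ N b) {b : Bool} {z z' : V N} (h : z.1 = b) (h' : z'.1 = b) :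
    pull hN b z = pull hN b z' ↔ z = z' := by
  obtain ⟨b', z⟩ := z
  obtain ⟨b'', z'⟩ := z'
  subst h
  subst h'
  simp [pull]

lemma forall_le_succ {t : ℕ} (P : ℕ → Prop) : (∀ s ≤ t+1, P s) ↔ ((∀ s ≤ t, P s) ∧ P (t+1)) := by
  constructor
  · intro h; exact ⟨fun s hs => h s (by omega), h _ le_rfl⟩
  · rintro ⟨h1, h2⟩ s hs
    rcases Nat.lt_or_ge t s with h | h
    · obtain rfl : s = t + 1 := by omega
      exact h2
    · exact h1 s h

theorem walk (Y : ∀ b, Fin k → ℕ → Ω b → Fin (N b)) (hY : ∀ b j t, Measurable (Y b j t))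
    (hN : ∀ b, 2 ≤ N b) (hw : ∀ b j, IsWalkLoopless (μ b) (Y b j))
    (hu : ∀ b j x, μ b {y | Y b j 0 y = x} = (N b : ENNReal)⁻¹) {M : ℕ} (e : V N ≃ Fin M)
    (hc1 : ∀ b, coin b {b} = ((N b - 1 : ℕ) : ENNReal) * ((M - 1 : ℕ) : ENNReal)⁻¹)
    (hc2 : ∀ b b', b' ≠ b → coin b {b'} = (N b' : ENNReal) * ((M - 1 : ℕ) : ENNReal)⁻¹)
    (j : Fin k) : IsWalkLoopless (PP coin μ) (fun t ω => e (W Y j t ω)) := by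
  intro t v
  obtain ⟨v', rfl⟩ : ∃ v' : ℕ → V N, v = fun s => e (v' s) := ⟨fun s => e.symm (v s), by simp⟩
  simp only [EmbeddingLike.apply_eq_iff_eq]
  let σ : ℕ → Bool := fun s => (v' s).1
  let A : ℕ → Set (Fin k → V N) := fun s => {c | c j = v' s}
  have aux : ∀ s ω, W Y j s ω = v' s ↔ (st ω s).1 = σ s ∧ (fun j => W Y j s ω) ∈ A s := by
    intro s ω
    constructor
    · intro h
      exact ⟨congrArg Sigma.fst h, h⟩
    · exact fun h => h.2
  have E1 : {ω | ∀ s ≤ t, W Y j s ω = v' s} = ev Y σ A t := by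
    ext ω
    simp only [ev, Set.mem_ofPred_eq, aux]
  have E2 : {ω | ∀ s ≤ t + 1, W Y j s ω = v' s} =
      {ω | ω ∈ ev Y σ A t ∧ (st ω (t+1)).1 = σ (t+1) ∧ (fun j => W Y j (t+1) ω) ∈ A (t+1)} := by
    ext ω
    simp only [ev, Set.mem_ofPred_eq, aux, forall_le_succ]
  rw [E1, E2]
  obtain ⟨R, h1, h2, h3⟩ := key coin μ Y hY σ A t
  by_cases hs : σ (t+1) = σ t
  · rw [hs, h2, h1]
    set L := lsw σ t with hL
    have hLt : L ≤ t := lsw_le σ t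
    have side : ∀ r ≤ t - L + 1, (v' (L + r)).1 = σ t := by
      intro r hr
      by_cases hr' : r = t - L + 1
      · rw [← hs, hr', show L + (t - L + 1) = t + 1 by omega]
      · exact (lsw_const σ t (L+r) (by omega) (by omega)).2
    have F1 : SS Y (σ t) L (t - L) A =
        {y | ∀ r ≤ t - L, Y (σ t) j r y = pull hN (σ t) (v' (L + r))} := by
      ext y
      simp only [SS, Set.mem_ofPred_eq, A]
      refine forall₂_congr fun r hr => ?_
      exact mk_eq_iff hN (side r (by omega)) _
    have F2 : {y | y ∈ SS Y (σ t) L (t - L) A ∧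
            (fun j => (⟨σ t, Y (σ t) j (t - L + 1) y⟩ : V N)) ∈ A (t+1)} =
        {y | ∀ r ≤ t - L + 1, Y (σ t) j r y = pull hN (σ t) (v' (L + r))} := by
      ext y
      rw [F1]
      simp only [Set.mem_ofPred_eq, A, forall_le_succ]
      refine and_congr_right fun _ => ?_
      have := mk_eq_iff hN (side (t - L + 1) le_rfl) (Y (σ t) j (t - L + 1) y)
      rw [← this, show L + (t - L + 1) = t + 1 by omega]
    rw [F2, F1, hw (σ t) j (t - L) (fun r => pull hN (σ t) (v' (L + r)))]
    have cond := pull_inj hN (side _ le_rfl) (side (t - L) (by omega))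
    rw [show L + (t - L + 1) = t + 1 by omega, show L + (t - L) = t by omega] at cond
    rw [hc1, show L + (t - L + 1) = t + 1 by omega, show L + (t - L) = t by omega]
    by_cases hv : v' (t+1) = v' t
    · rw [if_pos (cond.2 hv), if_pos hv]
      simp
    · rw [if_neg (fun h => hv (cond.1 h)), if_neg hv]
      have a1 : ((N (σ t) - 1 : ℕ) : ENNReal) ≠ 0 := by
        have := hN (σ t)
        exact_mod_cast (by omega : N (σ t) - 1 ≠ 0)
      have a2 := ENNReal.mul_inv_cancel a1 (ENNReal.natCast_ne_top _)
      calc _ = R * (μ (σ t)) {y | ∀ r ≤ t - L, Y (σ t) j r y = pull hN (σ t) (v' (L + r))}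
            * ((M - 1 : ℕ) : ENNReal)⁻¹ *
              (((N (σ t) - 1 : ℕ) : ENNReal) * ((N (σ t) - 1 : ℕ) : ENNReal)⁻¹) := by ring
        _ = _ := by rw [a2, mul_one]
  · rw [h3 _ _ hs, hc2 _ _ hs]
    have : {y | (fun j => (⟨σ (t+1), Y (σ (t+1)) j 0 y⟩ : V N)) ∈ A (t+1)} =
        {y | Y (σ (t+1)) j 0 y = pull hN (σ (t+1)) (v' (t+1))} := by
      ext y
      exact mk_eq_iff hN rfl _
    rw [this, hu, if_neg (fun h => hs (by simp only [σ, h]))]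
    have a1 : ((N (σ (t+1)) : ℕ) : ENNReal) ≠ 0 := by
      have := hN (σ (t+1))
      exact_mod_cast (by omega : N (σ (t+1)) ≠ 0)
    have a2 := ENNReal.mul_inv_cancel a1 (ENNReal.natCast_ne_top _)
    congr 1
    calc _ = ((M - 1 : ℕ) : ENNReal)⁻¹ *
          ((N (σ (t+1)) : ENNReal) * (N (σ (t+1)) : ENNReal)⁻¹) := by ring
      _ = _ := by rw [a2, mul_one]

theorem avoids (Y : ∀ b, Fin k → ℕ → Ω b → Fin (N b)) (ha : ∀ b, AvoidsAE (μ b) (Y b))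
    {M : ℕ} (e : V N ≃ Fin M) : AvoidsAE (PP coin μ) (fun j t ω => e (W Y j t ω)) := by
  have h1 : ∀ᵐ ω ∂(PP coin μ), ∀ (i : ℕ) (b : Bool),
    (∀ i' j : Fin k, i' ≠ j → Y b i' 0 ((ω i).2 b) ≠ Y b j 0 ((ω i).2 b)) ∧
    (∀ (t : ℕ) (i' j : Fin k),
      (i' < j → Y b j (t + 1) ((ω i).2 b) ≠ Y b i' (t + 1) ((ω i).2 b)) ∧
      (j < i' → Y b j (t + 1) ((ω i).2 b) ≠ Y b i' t ((ω i).2 b))) := by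
    rw [ae_all_iff]; intro i
    rw [ae_all_iff]; intro b
    have q1 : MeasurePreserving (fun ω : ℕ → E Ω => ω i) (PP coin μ) (ν coin μ) :=
      measurePreserving_eval_infinitePi (fun _ => ν coin μ) i
    have q2 : MeasurePreserving (Prod.snd : E Ω → _) (ν coin μ) (Measure.pi μ) :=
      measurePreserving_snd
    have q3 := ((measurePreserving_eval μ b).comp q2).comp q1
    exact q3.quasiMeasurePreserving.ae (ha b)
  filter_upwards [h1] with ω h
  simp only [ne_eq, EmbeddingLike.apply_eq_iff_eq]
  constructor
  · intro i j hij
    rw [W_eq Y (t := 0) (b := true) (L := 0) rfl, W_eq Y (t := 0) (b := true) (L := 0) rfl]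
    simpa using (h 0 true).1 i j hij
  · intro t i j
    obtain ⟨⟨b, L⟩, hbL⟩ : ∃ p, st ω t = p := ⟨_, rfl⟩
    have hL := st_le ω t
    rw [hbL] at hL
    simp only at hL
    by_cases hb : (ω (t+1)).1 b = b
    · have h2 : st ω (t+1) = (b, L) := by simp [st, hbL, hb]
      rw [W_eq Y h2, W_eq Y h2, W_eq Y hbL, show t + 1 - L = t - L + 1 by omega]
      simpa using (h L b).2 (t - L) i j
    · obtain ⟨b', hb'⟩ : ∃ b', (ω (t+1)).1 b = b' := ⟨_, rfl⟩
      rw [hb'] at hb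
      have h2 : st ω (t+1) = (b', t+1) := by simp [st, hbL, hb', hb]
      rw [W_eq Y h2, W_eq Y h2, W_eq Y hbL]
      constructor
      · intro hij
        simpa using (h (t+1) b').1 j i (ne_of_gt hij)
      · intro _ hh
        exact hb (congrArg Sigma.fst hh)

lemma meas_st (t : ℕ) : Measurable (fun ω : ℕ → E Ω => st ω t) := by
  induction t with
  | zero => exact measurable_const
  | succ t ih =>
    have g : Measurable (fun p : (Bool × ℕ) × (Bool → Bool) =>
        ((p.2 p.1.1, if p.2 p.1.1 = p.1.1 then p.1.2 else t + 1) : Bool × ℕ)) :=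
      measurable_of_countable _
    exact g.comp (ih.prodMk (measurable_fst.comp (measurable_pi_apply (t+1))))

lemma meas_W (Y : ∀ b, Fin k → ℕ → Ω b → Fin (N b)) (hY : ∀ b j t, Measurable (Y b j t))
    {M : ℕ} (e : V N ≃ Fin M) (j : Fin k) (t : ℕ) :
    Measurable (fun ω : ℕ → E Ω => e (W Y j t ω)) := by
  refine measurable_to_countable' fun x => ?_
  have : (fun ω : ℕ → E Ω => e (W Y j t ω)) ⁻¹' {x} = ⋃ p : Bool × ℕ,
      ((fun ω => st ω t) ⁻¹' {p}) ∩
      (fun ω : ℕ → E Ω => e ⟨p.1, Y p.1 j (t - p.2) ((ω p.2).2 p.1)⟩) ⁻¹' {x} := by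
    ext ω
    simp only [Set.mem_preimage, Set.mem_iUnion, Set.mem_inter_iff, Set.mem_singleton_iff]
    constructor
    · intro h
      exact ⟨_, rfl, h⟩
    · rintro ⟨p, hp, h⟩
      rw [W_eq Y hp]
      exact h
  rw [this]
  refine MeasurableSet.iUnion fun p => (meas_st t (measurableSet_singleton p)).inter ?_
  have m1 : Measurable (fun ω : ℕ → E Ω => (ω p.2).2 p.1) :=
    (measurable_pi_apply _).comp (measurable_snd.comp (measurable_pi_apply _))
  have m2 : Measurable (fun x : Fin (N p.1) => e ⟨p.1, x⟩) := measurable_of_countable _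
  exact (m2.comp ((hY p.1 j (t - p.2)).comp m1)) (measurableSet_singleton x)

end meas

section gen

lemma sum_fiber {Ω T : Type*} [MeasurableSpace Ω] [Fintype T] [MeasurableSpace T]
    [MeasurableSingletonClass T] (μ : Measure Ω) (S : Set Ω) (Z : Ω → T) (hZ : Measurable Z) :
    μ S = ∑ x, μ {ω | ω ∈ S ∧ Z ω = x} := by
  have h : ∀ x, μ {ω | ω ∈ S ∧ Z ω = x} = μ.restrict S (Z ⁻¹' {x}) := by
    intro x
    rw [Measure.restrict_apply (hZ (measurableSet_singleton x)), Set.inter_comm]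
    rfl
  simp only [h]
  rw [sum_measure_preimage_singleton _ (fun x _ => hZ (measurableSet_singleton x))]
  simp

/-- The Markov formula with explicit weights. -/
def MkF {Ω : Type} [MeasurableSpace Ω] (μ : Measure Ω) {n k : ℕ}
    (X : Fin k → ℕ → Ω → Fin n) (g : Fin k → (Fin k → Fin n) → Fin n → ENNReal) : Prop :=
    ∀ (t : ℕ) (j : Fin k) (v : Fin k → ℕ → Fin n) (w : Fin n),
      μ {ω | ((∀ i : Fin k, ∀ s ≤ t, X i s ω = v i s) ∧
              (∀ i < j, X i (t + 1) ω = v i (t + 1))) ∧ X j (t + 1) ω = w} =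
        μ {ω | (∀ i : Fin k, ∀ s ≤ t, X i s ω = v i s) ∧
               (∀ i < j, X i (t + 1) ω = v i (t + 1))} *
          g j (fun i => if i < j then v i (t + 1) else v i t) w

lemma markov_of_weights {Ω : Type} [MeasurableSpace Ω] (μ : Measure Ω) [IsProbabilityMeasure μ]
    {n k : ℕ} (X : Fin k → ℕ → Ω → Fin n) (hX : ∀ j t, Measurable (X j t))
    (g : Fin k → (Fin k → Fin n) → Fin n → ENNReal) (hg : MkF μ X g) :
    IsMarkovianCoupling μ X := by
  have : ∀ j c, ∃ p : PMF (Fin n), ∀ (t : ℕ) (v : Fin k → ℕ → Fin n) (w : Fin n),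
      (fun i => if i < j then v i (t + 1) else v i t) = c →
      μ {ω | ((∀ i : Fin k, ∀ s ≤ t, X i s ω = v i s) ∧
              (∀ i < j, X i (t + 1) ω = v i (t + 1))) ∧ X j (t + 1) ω = w} =
        μ {ω | (∀ i : Fin k, ∀ s ≤ t, X i s ω = v i s) ∧
               (∀ i < j, X i (t + 1) ω = v i (t + 1))} * p w := by
    intro j c
    by_cases h : ∃ (t : ℕ) (v : Fin k → ℕ → Fin n),
        (fun i => if i < j then v i (t + 1) else v i t) = c ∧
        μ {ω | (∀ i : Fin k, ∀ s ≤ t, X i s ω = v i s) ∧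
               (∀ i < j, X i (t + 1) ω = v i (t + 1))} ≠ 0
    · obtain ⟨t, v, rfl, h0⟩ := h
      set c := (fun i => if i < j then v i (t + 1) else v i t) with hc
      have hsum : ∑ w, g j c w = 1 := by
        have := sum_fiber μ {ω | (∀ i : Fin k, ∀ s ≤ t, X i s ω = v i s) ∧
               (∀ i < j, X i (t + 1) ω = v i (t + 1))} (X j (t+1)) (hX j (t+1))
        simp only [Set.mem_ofPred_eq] at this
        simp only [hg t j v] at this
        rw [← Finset.mul_sum] at this
        have h2 := (ENNReal.mul_right_inj h0 (measure_ne_top _ _)).1 ((mul_one _).trans this)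
        exact h2.symm
      refine ⟨PMF.ofFintype (g j c) hsum, fun t' v' w hc' => ?_⟩
      rw [hg t' j v' w, hc', PMF.ofFintype_apply]
    · refine ⟨PMF.pure (c j), fun t v w hc => ?_⟩
      have h0 : μ {ω | (∀ i : Fin k, ∀ s ≤ t, X i s ω = v i s) ∧
               (∀ i < j, X i (t + 1) ω = v i (t + 1))} = 0 := by
        by_contra h0
        exact h ⟨t, v, hc, h0⟩
      rw [h0, zero_mul]
      exact measure_mono_null (fun ω h => h.1) h0
  choose p hp using this
  exact ⟨p, fun t j v w => hp j _ t v w rfl⟩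

end gen

section mk
variable [∀ b, MeasurableSpace (Ω b)] (coin : Bool → Measure Bool) (μ : ∀ b, Measure (Ω b))
variable [∀ b, IsProbabilityMeasure (coin b)] [∀ b, IsProbabilityMeasure (μ b)]

open Classical in
/-- transition weights of the combined coupling -/
noncomputable def gg (Y : ∀ b, Fin k → ℕ → Ω b → Fin (N b)) (hN : ∀ b, 2 ≤ N b)
    (f : ∀ b, Fin k → (Fin k → Fin (N b)) → Fin (N b) → ENNReal) (i0 : Fin k)
    (j : Fin k) (c : Fin k → V N) (w : V N) : ENNReal :=
  if j = i0 then
    if w.1 = (c j).1 then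
      coin (c j).1 {(c j).1} *
        f (c j).1 j (fun i => pull hN (c j).1 (c i)) (pull hN (c j).1 w)
    else coin (c j).1 {w.1} * μ w.1 {y | (⟨w.1, Y w.1 j 0 y⟩ : V N) = w}
  else if w.1 ≠ (c i0).1 then 0
  else if w.1 = (c j).1 then f (c j).1 j (fun i => pull hN (c j).1 (c i)) (pull hN (c j).1 w)
  else (μ w.1 {y | ∀ i < j, (⟨w.1, Y w.1 i 0 y⟩ : V N) = c i})⁻¹ *
    μ w.1 {y | (∀ i < j, (⟨w.1, Y w.1 i 0 y⟩ : V N) = c i) ∧ (⟨w.1, Y w.1 j 0 y⟩ : V N) = w}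

open Classical in
lemma gg_eq (Y : ∀ b, Fin k → ℕ → Ω b → Fin (N b)) (hN : ∀ b, 2 ≤ N b)
    (f : ∀ b, Fin k → (Fin k → Fin (N b)) → Fin (N b) → ENNReal) (i0 : Fin k)
    (j : Fin k) (c : Fin k → V N) (w : V N) (b : Bool) (hb : (c j).1 = b) :
    gg coin μ Y hN f i0 j c w =
  if j = i0 then
    if w.1 = b then
      coin b {b} * f b j (fun i => pull hN b (c i)) (pull hN b w)
    else coin b {w.1} * μ w.1 {y | (⟨w.1, Y w.1 j 0 y⟩ : V N) = w}
  else if w.1 ≠ (c i0).1 then 0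
  else if w.1 = b then f b j (fun i => pull hN b (c i)) (pull hN b w)
  else (μ w.1 {y | ∀ i < j, (⟨w.1, Y w.1 i 0 y⟩ : V N) = c i})⁻¹ *
    μ w.1 {y | (∀ i < j, (⟨w.1, Y w.1 i 0 y⟩ : V N) = c i) ∧ (⟨w.1, Y w.1 j 0 y⟩ : V N) = w} := by
  subst hb
  rfl

theorem markovV (Y : ∀ b, Fin k → ℕ → Ω b → Fin (N b)) (hY : ∀ b j t, Measurable (Y b j t))
    (hN : ∀ b, 2 ≤ N b)
    (f : ∀ b, Fin k → (Fin k → Fin (N b)) → Fin (N b) → ENNReal)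
    (hf : ∀ b, MkF (μ b) (Y b) (f b)) (i0 : Fin k) (hi0 : ∀ i, i0 ≤ i)
    (t : ℕ) (j : Fin k) (v : Fin k → ℕ → V N) (w : V N) :
      PP coin μ {ω | ((∀ i : Fin k, ∀ s ≤ t, W Y i s ω = v i s) ∧
              (∀ i < j, W Y i (t + 1) ω = v i (t + 1))) ∧ W Y j (t + 1) ω = w} =
        PP coin μ {ω | (∀ i : Fin k, ∀ s ≤ t, W Y i s ω = v i s) ∧
               (∀ i < j, W Y i (t + 1) ω = v i (t + 1))} *
          gg coin μ Y hN f i0 j (fun i => if i < j then v i (t + 1) else v i t) w := by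
  by_cases hs : ∀ s ≤ t, ∀ i, (v i s).1 = (v i0 s).1
  swap
  · have h0 : PP coin μ {ω | (∀ i : Fin k, ∀ s ≤ t, W Y i s ω = v i s) ∧
               (∀ i < j, W Y i (t + 1) ω = v i (t + 1))} = 0 := by
      convert measure_empty (μ := PP coin μ)
      ext ω
      simp only [Set.mem_ofPred_eq, Set.mem_empty_iff_false, iff_false]
      rintro ⟨h, -⟩
      apply hs
      intro s hs i
      rw [← h i s hs, ← h i0 s hs]
      rfl
    rw [h0, zero_mul]
    exact measure_mono_null (fun ω h => h.1) h0
  let σ : ℕ → Bool := fun s => (v i0 s).1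
  let A : ℕ → Set (Fin k → V N) := fun s => {c | ∀ i, c i = v i s}
  have E1 : ∀ ω, (∀ i : Fin k, ∀ s ≤ t, W Y i s ω = v i s) ↔ ω ∈ ev Y σ A t := by
    intro ω
    simp only [ev, Set.mem_ofPred_eq, A]
    constructor
    · intro h s hs
      exact ⟨congrArg Sigma.fst (h i0 s hs), fun i => h i s hs⟩
    · intro h i s hs
      exact (h s hs).2 i
  obtain ⟨R, h1, h2, h3⟩ := key coin μ Y hY σ A t
  set L := lsw σ t with hL
  have hLt : L ≤ t := lsw_le σ t
  have side : ∀ r ≤ t - L, ∀ i, (v i (L + r)).1 = σ t := by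
    intro r hr i
    rw [hs _ (by omega)]
    exact (lsw_const σ t (L+r) (by omega) (by omega)).2
  have sidet : ∀ i, (v i t).1 = σ t := fun i => hs t le_rfl i
  have eL1 : L + (t - L + 1) = t + 1 := by omega
  have eL0 : L + (t - L) = t := by omega
  have F1 : ∀ y, y ∈ SS Y (σ t) L (t - L) A ↔
      (∀ i, ∀ r ≤ t - L, Y (σ t) i r y = pull hN (σ t) (v i (L + r))) := by
    intro y
    simp only [SS, Set.mem_ofPred_eq, A]
    constructor
    · intro h i r hr
      exact (mk_eq_iff hN (side r hr i) _).1 (h r hr i)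
    · intro h r hr i
      exact (mk_eq_iff hN (side r hr i) _).2 (h i r hr)
  have hfj := fun w' => hf (σ t) (t - L) j (fun i r => pull hN (σ t) (v i (L + r))) w'
  simp only [eL1, eL0, ← F1] at hfj
  have cj : (if j < j then v j (t + 1) else v j t) = v j t := if_neg (lt_irrefl _)
  rw [gg_eq coin μ Y hN f i0 j _ w (σ t) ((congrArg Sigma.fst cj).trans (sidet j))]
  by_cases hj : j = i0
  · have nolt : ∀ i, ¬ i < j := fun i h => absurd (hi0 i) (not_le.2 (hj ▸ h))
    have H2 : {ω | ((∀ i : Fin k, ∀ s ≤ t, W Y i s ω = v i s) ∧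
              (∀ i < j, W Y i (t + 1) ω = v i (t + 1))) ∧ W Y j (t + 1) ω = w} =
        {ω | ω ∈ ev Y σ A t ∧ (st ω (t+1)).1 = w.1 ∧ (fun j => W Y j (t+1) ω) ∈
          {c : Fin k → V N | c j = w}} := by
      ext ω
      simp only [Set.mem_ofPred_eq, E1, nolt, false_imp_iff, implies_true, and_true]
      refine and_congr_right fun _ => ⟨fun h => ⟨congrArg Sigma.fst h, h⟩, fun h => h.2⟩
    have H1 : {ω | (∀ i : Fin k, ∀ s ≤ t, W Y i s ω = v i s) ∧
               (∀ i < j, W Y i (t + 1) ω = v i (t + 1))} = ev Y σ A t := by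
      ext ω
      simp only [Set.mem_ofPred_eq, E1, nolt, false_imp_iff, implies_true, and_true]
    rw [H1, H2]
    simp only [nolt, if_false, false_imp_iff, implies_true, and_true] at hfj ⊢
    simp only [if_pos hj]
    by_cases hw : w.1 = σ t
    · rw [if_pos hw, hw, h2, h1]
      have := hfj (pull hN (σ t) w)
      simp only [← mk_eq_iff hN hw] at this
      simp only [Set.ofPred_mem_eq] at this
      simp only [Set.mem_ofPred_eq]
      rw [this]
      ring
    · rw [if_neg hw, h3 _ _ hw]
      simp only [Set.mem_ofPred_eq]
  · have hlt : i0 < j := lt_of_le_of_ne (hi0 j) (Ne.symm hj)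
    simp only [if_neg hj, if_pos hlt]
    by_cases hw0 : w.1 = (v i0 (t+1)).1
    swap
    · rw [if_pos hw0, mul_zero]
      convert measure_empty (μ := PP coin μ)
      ext ω
      simp only [Set.mem_ofPred_eq, Set.mem_empty_iff_false, iff_false]
      rintro ⟨⟨-, h⟩, h'⟩
      apply hw0
      rw [← h', ← h i0 hlt]
      rfl
    rw [if_neg (not_not.2 hw0)]
    have H2 : {ω | ((∀ i : Fin k, ∀ s ≤ t, W Y i s ω = v i s) ∧
              (∀ i < j, W Y i (t + 1) ω = v i (t + 1))) ∧ W Y j (t + 1) ω = w} =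
        {ω | ω ∈ ev Y σ A t ∧ (st ω (t+1)).1 = w.1 ∧ (fun j => W Y j (t+1) ω) ∈
          {c : Fin k → V N | (∀ i < j, c i = v i (t+1)) ∧ c j = w}} := by
      ext ω
      simp only [Set.mem_ofPred_eq, E1, and_assoc]
      refine and_congr_right fun _ => ⟨fun h => ⟨congrArg Sigma.fst h.2, h⟩, fun h => h.2⟩
    have H1 : {ω | (∀ i : Fin k, ∀ s ≤ t, W Y i s ω = v i s) ∧
               (∀ i < j, W Y i (t + 1) ω = v i (t + 1))} =
        {ω | ω ∈ ev Y σ A t ∧ (st ω (t+1)).1 = w.1 ∧ (fun j => W Y j (t+1) ω) ∈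
          {c : Fin k → V N | (∀ i < j, c i = v i (t+1))}} := by
      ext ω
      simp only [Set.mem_ofPred_eq, E1]
      refine and_congr_right fun _ => ⟨fun h => ⟨?_, h⟩, fun h => h.2⟩
      rw [hw0]
      exact congrArg Sigma.fst (h i0 hlt)
    rw [H1, H2]
    by_cases hw : w.1 = σ t
    · rw [if_pos hw, hw, h2, h2]
      simp only [Set.mem_ofPred_eq]
      by_cases hsd : ∀ i < j, (v i (t+1)).1 = σ t
      · have := hfj (pull hN (σ t) w)
        simp only [← mk_eq_iff hN hw] at this
        have G : ∀ y, (∀ i < j, Y (σ t) i (t - L + 1) y = pull hN (σ t) (v i (t+1))) ↔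
            (∀ i < j, (⟨σ t, Y (σ t) i (t - L + 1) y⟩ : V N) = v i (t+1)) := by
          intro y
          exact forall₂_congr fun i hi => (mk_eq_iff hN (hsd i hi) _).symm
        simp only [G] at this
        have G2 : (fun i => if i < j then pull hN (σ t) (v i (t + 1)) else pull hN (σ t) (v i t)) =
            fun i => pull hN (σ t) (if i < j then v i (t + 1) else v i t) := by
          funext i
          split_ifs <;> rfl
        rw [G2] at this
        simp only [← and_assoc]
        rw [this]
        ring
      · have h0 : μ (σ t) {y | y ∈ SS Y (σ t) L (t - L) A ∧
            (∀ i < j, (⟨σ t, Y (σ t) i (t - L + 1) y⟩ : V N) = v i (t+1))} = 0 := by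
          convert measure_empty (μ := μ (σ t))
          ext y
          simp only [Set.mem_ofPred_eq, Set.mem_empty_iff_false, iff_false]
          rintro ⟨-, h⟩
          exact hsd fun i hi => by rw [← h i hi]
        have h0' : μ (σ t) {y | y ∈ SS Y (σ t) L (t - L) A ∧
            (∀ i < j, (⟨σ t, Y (σ t) i (t - L + 1) y⟩ : V N) = v i (t+1)) ∧
              (⟨σ t, Y (σ t) j (t - L + 1) y⟩ : V N) = w} = 0 := by
          refine measure_mono_null ?_ h0
          intro y h
          exact ⟨h.1, h.2.1⟩
        rw [h0, h0']
        simp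
    · rw [if_neg hw, h3 _ _ hw, h3 _ _ hw]
      simp only [Set.mem_ofPred_eq]
      have G : ∀ y, (∀ i < j, (⟨w.1, Y w.1 i 0 y⟩ : V N) =
          if i < j then v i (t + 1) else v i t) ↔
          (∀ i < j, (⟨w.1, Y w.1 i 0 y⟩ : V N) = v i (t+1)) := by
        intro y
        exact forall₂_congr fun i hi => by rw [if_pos hi]
      simp only [G]
      set a := μ w.1 {y | ∀ i < j, (⟨w.1, Y w.1 i 0 y⟩ : V N) = v i (t+1)} with ha
      set a' := μ w.1 {y | (∀ i < j, (⟨w.1, Y w.1 i 0 y⟩ : V N) = v i (t+1)) ∧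
        (⟨w.1, Y w.1 j 0 y⟩ : V N) = w} with ha'
      have hle : a' ≤ a := measure_mono fun y h => h.1
      have : a * (a⁻¹ * a') = a' := by
        by_cases h0 : a = 0
        · rw [h0] at hle ⊢
          simp [le_antisymm hle zero_le]
        · rw [← mul_assoc, ENNReal.mul_inv_cancel h0 (measure_ne_top _ _), one_mul]
      calc _ = PP coin μ (ev Y σ A t) * (coin (σ t) {w.1} * (a * (a⁻¹ * a'))) := by rw [this]
        _ = _ := by ring

theorem markov (Y : ∀ b, Fin k → ℕ → Ω b → Fin (N b)) (hY : ∀ b j t, Measurable (Y b j t))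
    (hN : ∀ b, 2 ≤ N b) (hk : 1 ≤ k) {M : ℕ} (e : V N ≃ Fin M)
    (hf : ∀ b, IsMarkovianCoupling (μ b) (Y b)) :
    IsMarkovianCoupling (PP coin μ) (fun j t ω => e (W Y j t ω)) := by
  choose f hf using hf
  refine markov_of_weights _ _ (fun j t => meas_W Y hY e j t)
    (fun j c w => gg coin μ Y hN (fun b j c w => f b j c w) ⟨0, hk⟩ j
      (fun i => e.symm (c i)) (e.symm w)) ?_
  intro t j v w
  have := markovV coin μ Y hY hN (fun b j c w => f b j c w) hf ⟨0, hk⟩ (fun i => Nat.zero_le _)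
    t j (fun i s => e.symm (v i s)) (e.symm w)
  simp only [Equiv.eq_symm_apply] at this
  rw [this]
  congr 3
  funext i
  by_cases h : i < j <;> simp [h]

end mk

section unif
variable {Ω₀ Ω₁ : Type} [MeasurableSpace Ω₀] [MeasurableSpace Ω₁] {n : ℕ}

lemma walk_map (μ : Measure Ω₀) (φ : Ω₀ → Ω₁) (hφ : Measurable φ) (X : ℕ → Ω₁ → Fin n)
    (hX : ∀ t, Measurable (X t)) (h : IsWalkLoopless μ (fun t ω => X t (φ ω))) :
    IsWalkLoopless (μ.map φ) X := by
  intro t v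
  have hm : ∀ t, MeasurableSet {ω | ∀ s ≤ t, X s ω = v s} := by
    intro t
    have : {ω | ∀ s ≤ t, X s ω = v s} = ⋂ s, ⋂ (_ : s ≤ t), X s ⁻¹' {v s} := by ext; simp
    rw [this]
    exact MeasurableSet.iInter fun s => MeasurableSet.iInter fun _ =>
      hX s (measurableSet_singleton _)
  rw [Measure.map_apply hφ (hm _), Measure.map_apply hφ (hm _)]
  exact h t v

lemma mkF_map (μ : Measure Ω₀) (φ : Ω₀ → Ω₁) (hφ : Measurable φ) (X : Fin k → ℕ → Ω₁ → Fin n)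
    (hX : ∀ j t, Measurable (X j t)) (g) (h : MkF μ (fun j t ω => X j t (φ ω)) g) :
    MkF (μ.map φ) X g := by
  intro t j v w
  have hm : MeasurableSet {ω | (∀ i : Fin k, ∀ s ≤ t, X i s ω = v i s) ∧
               (∀ i < j, X i (t + 1) ω = v i (t + 1))} := by
    have : {ω | (∀ i : Fin k, ∀ s ≤ t, X i s ω = v i s) ∧
               (∀ i < j, X i (t + 1) ω = v i (t + 1))} =
      (⋂ i, ⋂ s, ⋂ (_ : s ≤ t), X i s ⁻¹' {v i s}) ∩
      ⋂ i, ⋂ (_ : i < j), X i (t+1) ⁻¹' {v i (t+1)} := by ext; simp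
    rw [this]
    exact (MeasurableSet.iInter fun i => MeasurableSet.iInter fun s => MeasurableSet.iInter fun _ =>
      hX i s (measurableSet_singleton _)).inter
      (MeasurableSet.iInter fun i => MeasurableSet.iInter fun _ =>
      hX i _ (measurableSet_singleton _))
  have hm2 : MeasurableSet {ω | ((∀ i : Fin k, ∀ s ≤ t, X i s ω = v i s) ∧
               (∀ i < j, X i (t + 1) ω = v i (t + 1))) ∧ X j (t+1) ω = w} :=
    hm.inter (hX j (t+1) (measurableSet_singleton w))
  rw [Measure.map_apply hφ hm, Measure.map_apply hφ hm2]
  exact h t j v w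

lemma walk_mix (μ μ' : Measure Ω₀) (a b : ENNReal) (X : ℕ → Ω₀ → Fin n)
    (h : IsWalkLoopless μ X) (h' : IsWalkLoopless μ' X) :
    IsWalkLoopless (a • μ + b • μ') X := by
  intro t v
  simp only [Measure.add_apply, Measure.smul_apply, smul_eq_mul]
  rw [h t v, h' t v]
  ring

lemma mkF_mix (μ μ' : Measure Ω₀) (a b : ENNReal) (X : Fin k → ℕ → Ω₀ → Fin n) (g)
    (h : MkF μ X g) (h' : MkF μ' X g) : MkF (a • μ + b • μ') X g := by
  intro t j v w
  simp only [Measure.add_apply, Measure.smul_apply, smul_eq_mul]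
  rw [h t j v w, h' t j v w]
  ring

/-- prepend a value to a sequence -/
def consSeq {T : Type*} (x : T) (v : ℕ → T) : ℕ → T
  | 0 => x
  | s + 1 => v s

lemma forall_le_succ' {t : ℕ} (P : ℕ → Prop) :
    (∀ s ≤ t+1, P s) ↔ (P 0 ∧ (∀ s ≤ t, P (s+1))) := by
  constructor
  · intro h; exact ⟨h 0 (by omega), fun s hs => h _ (by omega)⟩
  · rintro ⟨h1, h2⟩ s hs
    cases s with
    | zero => exact h1
    | succ s => exact h2 s (by omega)

lemma walk_shift (μ : Measure Ω₀) (X : ℕ → Ω₀ → Fin n)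
    (hX : ∀ t, Measurable (X t)) (h : IsWalkLoopless μ X) :
    IsWalkLoopless μ (fun t => X (t+1)) := by
  intro t v
  have aux : ∀ t, μ {ω | ∀ s ≤ t, X (s+1) ω = v s} =
      ∑ x, μ {ω | ∀ s ≤ t + 1, X s ω = consSeq x v s} := by
    intro t
    rw [sum_fiber μ _ (X 0) (hX 0)]
    refine Finset.sum_congr rfl fun x _ => ?_
    congr 1
    ext ω
    simp only [Set.mem_ofPred_eq, forall_le_succ', consSeq]
    tauto
  rw [aux, aux, Finset.sum_mul]
  refine Finset.sum_congr rfl fun x _ => ?_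
  exact h (t+1) (consSeq x v)

lemma mkF_shift (μ : Measure Ω₀) (X : Fin k → ℕ → Ω₀ → Fin n)
    (hX : ∀ j t, Measurable (X j t)) (g) (h : MkF μ X g) :
    MkF μ (fun j t => X j (t+1)) g := by
  intro t j v w
  have hm : Measurable (fun ω i => X i 0 ω) := measurable_pi_iff.2 fun i => hX i 0
  rw [sum_fiber μ _ _ hm]
  rw [sum_fiber μ {ω | (∀ i : Fin k, ∀ s ≤ t, X i (s+1) ω = v i s) ∧
               (∀ i < j, X i (t + 1 + 1) ω = v i (t + 1))} _ hm, Finset.sum_mul]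
  refine Finset.sum_congr rfl fun x _ => ?_
  have := h (t+1) j (fun i => consSeq (x i) (v i)) w
  convert this using 2
  · congr 1
    ext ω
    simp only [Set.mem_ofPred_eq, forall_le_succ', consSeq, funext_iff, forall_and]
    tauto
  · congr 1
    ext ω
    simp only [Set.mem_ofPred_eq, forall_le_succ', consSeq, funext_iff, forall_and]
    tauto
  · rfl

lemma walk_one (μ : Measure Ω₀) [IsProbabilityMeasure μ] (hn : 2 ≤ n) (X : ℕ → Ω₀ → Fin n)
    (hX : ∀ t, Measurable (X t)) (h : IsWalkLoopless μ X) (x : Fin n) :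
    μ {ω | X 0 ω = x} + ((n - 1 : ℕ) : ENNReal) * μ {ω | X 1 ω = x} = 1 := by
  have a1 : ((n - 1 : ℕ) : ENNReal) ≠ 0 := by
    exact_mod_cast (by omega : n - 1 ≠ 0)
  have a2 := ENNReal.mul_inv_cancel a1 (ENNReal.natCast_ne_top _)
  have b1 : μ {ω | X 1 ω = x} = ∑ y, μ {ω | X 0 ω = y} *
      (if x = y then 0 else ((n - 1 : ℕ) : ENNReal)⁻¹) := by
    rw [sum_fiber μ _ (X 0) (hX 0)]
    refine Finset.sum_congr rfl fun y _ => ?_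
    have := h 0 (consSeq y fun _ => x)
    simp only [forall_le_succ', consSeq, Nat.le_zero, forall_eq, zero_add] at this
    refine Eq.trans ?_ (this.trans ?_)
    swap
    · congr
    congr 1
    ext ω
    simp only [Set.mem_ofPred_eq]
    tauto
  have b2 : (1 : ENNReal) = ∑ y, μ {ω | X 0 ω = y} := by
    have := sum_fiber μ Set.univ (X 0) (hX 0)
    simpa using this
  rw [b1, b2, Finset.mul_sum, ← Finset.add_sum_erase _ _ (Finset.mem_univ x),
    ← Finset.add_sum_erase (a := x) _ (fun y => μ {ω | X 0 ω = y}) (Finset.mem_univ x)]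
  simp only [if_true, mul_zero, zero_add]
  congr 1
  refine Finset.sum_congr rfl fun y hy => ?_
  rw [if_neg (Finset.ne_of_mem_erase hy).symm, mul_comm, mul_assoc, mul_comm _⁻¹, a2, mul_one]

lemma avoids_shift (μ : Measure Ω₀) (X : Fin k → ℕ → Ω₀ → Fin n) (h : AvoidsAE μ X) :
    AvoidsAE μ (fun j t => X j (t+1)) := by
  filter_upwards [h] with ω h
  refine ⟨fun i j hij => ?_, fun t i j => h.2 (t+1) i j⟩
  rcases lt_or_gt_of_ne hij with h' | h'
  · exact ((h.2 0 i j).1 h').symm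
  · exact (h.2 0 j i).1 h'

lemma avoids_map (μ : Measure Ω₀) (φ : Ω₀ → Ω₁) (hφ : Measurable φ) (X : Fin k → ℕ → Ω₁ → Fin n)
    (hX : ∀ j t, Measurable (X j t)) (h : AvoidsAE μ (fun j t ω => X j t (φ ω))) :
    AvoidsAE (μ.map φ) X := by
  have hne : ∀ i s j t, MeasurableSet {ω | X i s ω ≠ X j t ω} := fun i s j t =>
    (measurableSet_eq_fun (hX i s) (hX j t)).compl
  unfold AvoidsAE at h ⊢
  simp only [ae_all_iff, Filter.eventually_and, Filter.eventually_imp_distrib_left]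
    at h ⊢
  refine ⟨fun i j hij => ?_, fun t i j => ⟨fun hij => ?_, fun hij => ?_⟩⟩
  · rw [ae_map_iff hφ.aemeasurable (hne _ _ _ _)]
    exact h.1 i j hij
  · rw [ae_map_iff hφ.aemeasurable (hne _ _ _ _)]
    exact (h.2 t i j).1 hij
  · rw [ae_map_iff hφ.aemeasurable (hne _ _ _ _)]
    exact (h.2 t i j).2 hij

theorem uniformize (μ : Measure Ω₀) [IsProbabilityMeasure μ] (hn : 2 ≤ n)
    (X : Fin k → ℕ → Ω₀ → Fin n) (hX : ∀ j t, Measurable (X j t))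
    (hw : ∀ j, IsWalkLoopless μ (X j)) (ha : AvoidsAE μ X) :
    ∃ (Ω' : Type) (_ : MeasurableSpace Ω') (μ' : Measure Ω') (X' : Fin k → ℕ → Ω' → Fin n),
      IsProbabilityMeasure μ' ∧ (∀ j t, Measurable (X' j t)) ∧
      (∀ j, IsWalkLoopless μ' (X' j)) ∧ AvoidsAE μ' X' ∧
      (∀ j x, μ' {y | X' j 0 y = x} = (n : ENNReal)⁻¹) ∧
      (IsMarkovianCoupling μ X → IsMarkovianCoupling μ' X') := by
  let φ₀ : Ω₀ → (ℕ → Fin k → Fin n) := fun ω t j => X j t ω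
  let φ₁ : Ω₀ → (ℕ → Fin k → Fin n) := fun ω t j => X j (t+1) ω
  have hφ₀ : Measurable φ₀ := measurable_pi_iff.2 fun t => measurable_pi_iff.2 fun j => hX j t
  have hφ₁ : Measurable φ₁ := measurable_pi_iff.2 fun t => measurable_pi_iff.2 fun j => hX j (t+1)
  let X' : Fin k → ℕ → (ℕ → Fin k → Fin n) → Fin n := fun j t p => p t j
  have hX' : ∀ j t, Measurable (X' j t) := fun j t =>
    (measurable_pi_apply j).comp (measurable_pi_apply t)
  have a1 : (n : ENNReal) ≠ 0 := by
    exact_mod_cast (by omega : n ≠ 0)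
  have a2 := ENNReal.mul_inv_cancel a1 (ENNReal.natCast_ne_top _)
  have a3 : ((n - 1 : ℕ) : ENNReal) + 1 = n := by
    exact_mod_cast (by omega : n - 1 + 1 = n)
  refine ⟨ℕ → Fin k → Fin n, inferInstance, (n : ENNReal)⁻¹ • μ.map φ₀ +
    ((n : ENNReal)⁻¹ * ((n - 1 : ℕ) : ENNReal)) • μ.map φ₁, X', ?_, hX', ?_, ?_, ?_, ?_⟩
  · constructor
    have := Measure.isProbabilityMeasure_map (μ := μ) hφ₀.aemeasurable
    have := Measure.isProbabilityMeasure_map (μ := μ) hφ₁.aemeasurable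
    simp only [Measure.add_apply, Measure.smul_apply, smul_eq_mul, measure_univ, mul_one]
    calc _ = (n : ENNReal)⁻¹ * (((n - 1 : ℕ) : ENNReal) + 1) := by ring
      _ = 1 := by rw [a3, mul_comm, a2]
  · intro j
    exact walk_mix _ _ _ _ _ (walk_map μ φ₀ hφ₀ _ (hX' j) (hw j))
      (walk_map μ φ₁ hφ₁ _ (hX' j) (walk_shift μ (X j) (hX j) (hw j)))
  · have h0 := avoids_map μ φ₀ hφ₀ X' hX' ha
    have h1 := avoids_map μ φ₁ hφ₁ X' hX' (avoids_shift μ X ha)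
    unfold AvoidsAE at *
    rw [ae_add_measure_iff]
    exact ⟨Measure.ae_smul_measure h0 _, Measure.ae_smul_measure h1 _⟩
  · intro j x
    have hm : MeasurableSet {y | X' j 0 y = x} := hX' j 0 (measurableSet_singleton x)
    simp only [Measure.add_apply, Measure.smul_apply, smul_eq_mul]
    rw [Measure.map_apply hφ₀ hm, Measure.map_apply hφ₁ hm]
    have := walk_one μ hn (X j) (hX j) (hw j) x
    calc _ = (n : ENNReal)⁻¹ * (μ {ω | X j 0 ω = x} +
          ((n - 1 : ℕ) : ENNReal) * μ {ω | X j 1 ω = x}) := by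
            rw [mul_add, ← mul_assoc]; rfl
      _ = _ := by rw [this, mul_one]
  · rintro ⟨f, hf⟩
    have hf' : MkF μ X (fun j c w => f j c w) := hf
    exact ⟨f, mkF_mix _ _ _ _ _ _ (mkF_map μ φ₀ hφ₀ X' hX' _ hf')
      (mkF_map μ φ₁ hφ₁ X' hX' _ (mkF_shift μ X hX _ hf'))⟩

end unif

lemma exists_coin (N : Bool → ℕ) (hN : ∀ b, 2 ≤ N b) (M : ℕ) (hM : N true + N false = M) :
    ∃ coin : Bool → Measure Bool, (∀ b, IsProbabilityMeasure (coin b)) ∧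
    (∀ b, coin b {b} = ((N b - 1 : ℕ) : ENNReal) * ((M - 1 : ℕ) : ENNReal)⁻¹) ∧
    (∀ b b', b' ≠ b → coin b {b'} = (N b' : ENNReal) * ((M - 1 : ℕ) : ENNReal)⁻¹) := by
  refine ⟨fun b => (((N b - 1 : ℕ) : ENNReal) * ((M - 1 : ℕ) : ENNReal)⁻¹) • Measure.dirac b +
    ((N (!b) : ENNReal) * ((M - 1 : ℕ) : ENNReal)⁻¹) • Measure.dirac (!b), ?_, ?_, ?_⟩
  · intro b
    constructor
    have a1 : ((M - 1 : ℕ) : ENNReal) ≠ 0 := by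
      have := hN true
      exact_mod_cast (by omega : M - 1 ≠ 0)
    have a2 := ENNReal.mul_inv_cancel a1 (ENNReal.natCast_ne_top _)
    simp only [Measure.add_apply, Measure.smul_apply, smul_eq_mul, measure_univ, mul_one]
    rw [← add_mul, ← Nat.cast_add, ← a2]
    congr 3
    have := hN b
    cases b <;> simp at * <;> omega
  · intro b
    simp
  · intro b b' h
    obtain rfl : b' = !b := by cases b <;> cases b' <;> simp at *
    simp

theorem combine (N : Bool → ℕ) (hN : ∀ b, 2 ≤ N b) (M k : ℕ) (hk : 1 ≤ k)
    (hM : N true + N false = M)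
    (Ω : Bool → Type) [∀ b, MeasurableSpace (Ω b)] (μ : ∀ b, Measure (Ω b))
    [∀ b, IsProbabilityMeasure (μ b)] (X : ∀ b, Fin k → ℕ → Ω b → Fin (N b))
    (hX : ∀ b j t, Measurable (X b j t)) (hw : ∀ b j, IsWalkLoopless (μ b) (X b j))
    (ha : ∀ b, AvoidsAE (μ b) (X b)) :
    ∃ (Ω' : Type) (_ : MeasurableSpace Ω') (μ' : Measure Ω') (X' : Fin k → ℕ → Ω' → Fin M),
      IsProbabilityMeasure μ' ∧ (∀ j t, Measurable (X' j t)) ∧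
      (∀ j, IsWalkLoopless μ' (X' j)) ∧ AvoidsAE μ' X' ∧
      ((∀ b, IsMarkovianCoupling (μ b) (X b)) → IsMarkovianCoupling μ' X') := by
  have H := fun b => uniformize (μ b) (hN b) (X b) (hX b) (hw b) (ha b)
  choose Ω' mΩ' μ' Y hp hY hw' ha' hu hm using H
  obtain ⟨coin, hcp, hc1, hc2⟩ := exists_coin N hN M hM
  have e : V N ≃ Fin M := Fintype.equivFinOfCardEq (by simp [hM])
  exact ⟨ℕ → E Ω', inferInstance, PP coin μ', fun j t ω => e (W Y j t ω), inferInstance,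
    meas_W Y hY e, walk coin μ' Y hY hN hw' hu e hc1 hc2, avoids coin μ' Y ha' e,
    fun h => markov coin μ' Y hY hN hk e (fun b => hm b (h b))⟩

end ACSum

/-- Sum lemma, loopless case: from avoidance couplings of `k` walkers on `K_m`
and on `K_n` one obtains an avoidance coupling of `k` walkers on `K_{m+n}`;
moreover, if the given couplings are Markovian then so is the resulting one. -/
theorem avoidance_coupling_loopless_sum (m n k : ℕ)
    (hm : 2 ≤ m) (hn : 2 ≤ n) (hk : 1 ≤ k) :
    (AvoidanceCouplingLoopless m k → AvoidanceCouplingLoopless n k →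
      AvoidanceCouplingLoopless (m + n) k) ∧
    (MarkovianAvoidanceCouplingLoopless m k → MarkovianAvoidanceCouplingLoopless n k →
      MarkovianAvoidanceCouplingLoopless (m + n) k) := by
  have hN : ∀ b : Bool, 2 ≤ (bif b then m else n) := by
    intro b; cases b <;> assumption
  constructor
  · intro h1 h2
    have H : ∀ b : Bool, AvoidanceCouplingLoopless (bif b then m else n) k := by
      intro b; cases b <;> assumption
    choose Ω mΩ μ X hp hX hw ha using H
    obtain ⟨Ω', i, μ', X', a, b, c, d, -⟩ := ACSum.combine _ hN (m + n) k hk rfl Ω μ X hX hw ha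
    exact ⟨Ω', i, μ', X', a, b, c, d⟩
  · intro h1 h2
    have H : ∀ b : Bool, MarkovianAvoidanceCouplingLoopless (bif b then m else n) k := by
      intro b; cases b <;> assumption
    choose Ω mΩ μ X hp hX hw ha hmk using H
    obtain ⟨Ω', i, μ', X', a, b, c, d, e⟩ := ACSum.combine _ hN (m + n) k hk rfl Ω μ X hX hw ha
    exact ⟨Ω', i, μ', X', a, b, c, d, e hmk⟩
end

section
/- Let m, n ≥ 2 and k ≥ 1 be integers. If there exist avoidance couplings of k walkers on the looped complete graph K_m^* and of k walkers on the looped complete graph K_n^*, then there exists an avoidance coupling of k walkers on K_{m+n}^*; moreover, if the two given couplings are Markovian, then the resulting coupling can be taken to be Markovian. -/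
open MeasureTheory ProbabilityTheory

namespace ACSum

/-- age of the current run of equal coins at time `t`. -/
def age (c : ℕ → Bool) : ℕ → ℕ
  | 0 => 0
  | t + 1 => if c (t + 1) = c t then age c t + 1 else 0

lemma age_le (c : ℕ → Bool) (t : ℕ) : age c t ≤ t := by
  induction t with
  | zero => simp [age]
  | succ t ih => simp only [age]; split_ifs <;> omega

lemma age_congr {c d : ℕ → Bool} {t : ℕ} (h : ∀ s ≤ t, c s = d s) : age c t = age d t := by
  induction t with
  | zero => simp [age]
  | succ t ih =>
    simp only [age]
    rw [h (t + 1) le_rfl, h t (by omega), ih (fun s hs => h s (by omega))]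

lemma age_run (d : ℕ → Bool) (t r : ℕ) (h1 : t - age d t ≤ r) (h2 : r ≤ t) :
    d r = d t ∧ age d r = r - (t - age d t) := by
  induction t with
  | zero =>
    obtain rfl : r = 0 := by omega
    simp [age]
  | succ t ih =>
    have hle := age_le d t
    rcases Nat.lt_or_ge t r with h | h
    · obtain rfl : r = t + 1 := by omega
      have := age_le d (t + 1)
      exact ⟨rfl, by omega⟩
    · by_cases hc : d (t + 1) = d t
      · have ha : age d (t + 1) = age d t + 1 := by simp [age, hc]
        rw [ha] at h1 ⊢
        obtain ⟨h3, h4⟩ := ih (by omega) h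
        exact ⟨h3.trans hc.symm, by omega⟩
      · have ha : age d (t + 1) = 0 := by simp [age, hc]
        omega

/-- The combined process. -/
def comb {Ω C : Type} (Z : Bool → ℕ → Ω → C) (t : ℕ) (ω : ℕ → Bool × Ω) : C :=
  Z (ω t).1 (age (fun s => (ω s).1) t) (ω (t - age (fun s => (ω s).1) t)).2

section core

variable {Ω C : Type} [MeasurableSpace Ω] [MeasurableSpace C] [DiscreteMeasurableSpace C]

lemma measurable_age (t : ℕ) :
    Measurable (fun ω : ℕ → Bool × Ω => age (fun s => (ω s).1) t) := by
  induction t with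
  | zero => simp only [age]; exact measurable_const
  | succ t ih =>
    simp only [age]
    refine Measurable.ite ?_ (by fun_prop) measurable_const
    exact measurableSet_eq_fun (by fun_prop) (by fun_prop)

lemma measurable_comb {Z : Bool → ℕ → Ω → C} (hZ : ∀ b u, Measurable (Z b u)) (t : ℕ) :
    Measurable (comb Z t) := by
  intro S hS
  have : comb Z t ⁻¹' S = ⋃ b : Bool, ⋃ a : ℕ,
      {ω | (ω t).1 = b} ∩ {ω | age (fun s => (ω s).1) t = a} ∩
        {ω | Z b a (ω (t - a)).2 ∈ S} := by
    ext ω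
    simp [comb]
  rw [this]
  refine MeasurableSet.iUnion fun b => MeasurableSet.iUnion fun a => ?_
  refine ((?_ : MeasurableSet _).inter ?_).inter ?_
  · exact (measurable_fst.comp (measurable_pi_apply t)) (measurableSet_singleton b)
  · exact measurable_age t (measurableSet_singleton a)
  · exact ((hZ b a).comp (measurable_snd.comp (measurable_pi_apply (t - a)))) hS

/-- The constraint of the first `T+1` steps on the coordinate `s`. -/
def blk (Z : Bool → ℕ → Ω → C) (d : ℕ → Bool) (D : ℕ → Set C) (T s : ℕ) : Set Ω :=
  {ω | ∀ r ≤ T, r - age d r = s → Z (d r) (age d r) ω ∈ D r}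

lemma measurableSet_blk {Z : Bool → ℕ → Ω → C} (hZ : ∀ b u, Measurable (Z b u))
    (d : ℕ → Bool) (D : ℕ → Set C) (T s : ℕ) : MeasurableSet (blk Z d D T s) := by
  have : blk Z d D T s =
      ⋂ r : ℕ, ⋂ _ : r ≤ T, ⋂ _ : r - age d r = s, Z (d r) (age d r) ⁻¹' (D r) := by
    ext ω; simp [blk]
  rw [this]
  exact MeasurableSet.iInter fun r => MeasurableSet.iInter fun _ =>
    MeasurableSet.iInter fun _ => hZ _ _ (MeasurableSet.of_discrete)

lemma event_eq {Z : Bool → ℕ → Ω → C} {d : ℕ → Bool} {D : ℕ → Set C} {T : ℕ}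
    (hD : ∀ s ≤ T, ∀ b u ω, Z b u ω ∈ D s → b = d s) :
    {ω | ∀ s ≤ T, comb Z s ω ∈ D s} =
      Set.pi (Finset.range (T + 1) : Finset ℕ) (fun s => {d s} ×ˢ blk Z d D T s) := by
  ext ω
  simp only [Set.mem_ofPred_eq, Set.mem_pi, Finset.coe_range, Set.mem_Iio, Set.mem_prod,
    Set.mem_singleton_iff]
  constructor
  · intro h
    have hc : ∀ s ≤ T, (ω s).1 = d s := fun s hs => hD s hs _ _ _ (h s hs)
    intro s hs
    refine ⟨hc s (by omega), ?_⟩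
    intro r hr hrs
    have h1 := h r hr
    rw [comb, hc r hr, age_congr (d := d) (fun s hs => hc s (hs.trans hr)), hrs] at h1
    exact h1
  · intro h s hs
    have hc : ∀ s ≤ T, (ω s).1 = d s := fun s hs => (h s (by omega)).1
    rw [comb, hc s hs, age_congr (d := d) (fun r hr => hc r (hr.trans hs))]
    exact (h (s - age d s) (by omega)).2 s hs rfl

variable {μ : Measure Ω} [IsProbabilityMeasure μ] {κ : Measure Bool} [IsProbabilityMeasure κ]

lemma measure_event {Z : Bool → ℕ → Ω → C} (hZ : ∀ b u, Measurable (Z b u))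
    {d : ℕ → Bool} {D : ℕ → Set C} {T : ℕ}
    (hD : ∀ s ≤ T, ∀ b u ω, Z b u ω ∈ D s → b = d s) :
    Measure.infinitePi (fun _ : ℕ => κ.prod μ) {ω | ∀ s ≤ T, comb Z s ω ∈ D s} =
      (∏ s ∈ Finset.range (T + 1), κ {d s}) *
        ∏ s ∈ Finset.range (T + 1), μ (blk Z d D T s) := by
  rw [event_eq hD, Measure.infinitePi_pi]
  · simp only [Measure.prod_prod, Finset.prod_mul_distrib]
  · intro i _
    exact (measurableSet_singleton _).prod (measurableSet_blk hZ d D T i)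

lemma step {Z : Bool → ℕ → Ω → C} (hZ : ∀ b u, Measurable (Z b u))
    (d : ℕ → Bool) (D : ℕ → Set C) (T : ℕ)
    (hD : ∀ s ≤ T, ∀ b u ω, Z b u ω ∈ D s → b = d s) (b : Bool) (a s0 : ℕ)
    (hb : b = d (T + 1)) (ha : a = age d (T + 1)) (hs : s0 = T + 1 - a) :
    ∃ R : ENNReal,
      Measure.infinitePi (fun _ : ℕ => κ.prod μ) {ω | ∀ s ≤ T, comb Z s ω ∈ D s} =
        R * μ {ω | ∀ u < a, Z b u ω ∈ D (s0 + u)} ∧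
      ∀ D' : Set C, (∀ b' u ω, Z b' u ω ∈ D' → b' = b) →
        Measure.infinitePi (fun _ : ℕ => κ.prod μ)
            {ω | (∀ s ≤ T, comb Z s ω ∈ D s) ∧ comb Z (T + 1) ω ∈ D'} =
          R * κ {b} * μ {ω | (∀ u < a, Z b u ω ∈ D (s0 + u)) ∧ Z b a ω ∈ D'} := by
  have hale := age_le d (T + 1)
  have hG : blk Z d D T s0 = {ω | ∀ u < a, Z b u ω ∈ D (s0 + u)} := by
    ext ω
    simp only [blk, Set.mem_ofPred_eq]
    constructor
    · intro h u hu
      obtain ⟨h1, h2⟩ := age_run d (T + 1) (s0 + u) (by omega) (by omega)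
      have := h (s0 + u) (by omega) (by omega)
      rwa [h1, h2, ← hb, show s0 + u - (T + 1 - age d (T + 1)) = u by omega] at this
    · intro h r hr hrs
      obtain ⟨h1, h2⟩ := age_run d (T + 1) r (by omega) (by omega)
      rw [h1, h2, ← hb]
      have := h (r - s0) (by omega)
      rwa [show s0 + (r - s0) = r by omega, show r - s0 = r - (T + 1 - age d (T + 1)) by omega]
        at this
  have hlast : blk Z d D T (T + 1) = Set.univ := by
    ext ω
    simp only [blk, Set.mem_ofPred_eq, Set.mem_univ, iff_true]
    intro r hr hrs
    omega
  have hmem : s0 ∈ Finset.range (T + 2) := by simp; omega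
  refine ⟨(∏ s ∈ Finset.range (T + 1), κ {d s}) *
    ∏ s ∈ (Finset.range (T + 2)).erase s0, μ (blk Z d D T s), ?_, ?_⟩
  · rw [measure_event hZ hD, ← hG, mul_assoc, Finset.prod_erase_mul _ _ hmem,
      Finset.prod_range_succ _ (T + 1), hlast, measure_univ, mul_one]
  · intro D' hD'
    set E : ℕ → Set C := fun s => if s = T + 1 then D' else D s with hE
    have hEl : E (T + 1) = D' := by simp [hE]
    have hEs : ∀ s ≤ T, E s = D s := fun s hs => by
      simp only [hE]; rw [if_neg (by omega)]
    have hset : {ω | (∀ s ≤ T, comb Z s ω ∈ D s) ∧ comb Z (T + 1) ω ∈ D'} =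
        {ω | ∀ s ≤ T + 1, comb Z s ω ∈ E s} := by
      ext ω
      simp only [Set.mem_ofPred_eq]
      constructor
      · rintro ⟨h1, h2⟩ s hs
        rcases Nat.lt_or_ge T s with h | h
        · obtain rfl : s = T + 1 := by omega
          rwa [hEl]
        · rw [hEs s h]; exact h1 s h
      · intro h
        refine ⟨fun s hs => hEs s hs ▸ h s (by omega), hEl ▸ h (T + 1) le_rfl⟩
    have hED : ∀ s ≤ T + 1, ∀ b u ω, Z b u ω ∈ E s → b = d s := by
      intro s hs b' u ω h
      rcases Nat.lt_or_ge T s with h' | h'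
      · obtain rfl : s = T + 1 := by omega
        rw [hEl] at h
        exact (hD' b' u ω h).trans hb
      · rw [hEs s h'] at h; exact hD s h' b' u ω h
    have hne : ∀ s ∈ (Finset.range (T + 2)).erase s0,
        μ (blk Z d E (T + 1) s) = μ (blk Z d D T s) := by
      intro s hs'
      congr 1
      ext ω
      simp only [blk, Set.mem_ofPred_eq]
      constructor
      · intro h r hr hrs
        rw [← hEs r hr]; exact h r (by omega) hrs
      · intro h r hr hrs
        rcases Nat.lt_or_ge T r with h' | h'
        · obtain rfl : r = T + 1 := by omega
          exact absurd (by omega) (Finset.ne_of_mem_erase hs')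
        · rw [hEs r h']; exact h r h' hrs
    have heq : blk Z d E (T + 1) s0 =
        {ω | (∀ u < a, Z b u ω ∈ D (s0 + u)) ∧ Z b a ω ∈ D'} := by
      have : blk Z d E (T + 1) s0 = {ω | ω ∈ blk Z d D T s0 ∧ Z b a ω ∈ D'} := by
        ext ω
        simp only [blk, Set.mem_ofPred_eq]
        constructor
        · intro h
          refine ⟨fun r hr hrs => ?_, ?_⟩
          · rw [← hEs r hr]; exact h r (by omega) hrs
          · have := h (T + 1) le_rfl (by omega)
            rwa [hEl, ← hb, ← ha] at this
        · rintro ⟨h1, h2⟩ r hr hrs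
          rcases Nat.lt_or_ge T r with h' | h'
          · obtain rfl : r = T + 1 := by omega
            rwa [hEl, ← hb, ← ha]
          · rw [hEs r h']; exact h1 r h' hrs
      rw [this, hG]; rfl
    rw [hset, measure_event hZ hED,
      ← Finset.prod_erase_mul _ (fun s => μ (blk Z d E (T + 1) s)) hmem, heq,
      Finset.prod_congr rfl hne, Finset.prod_range_succ _ (T + 1), ← hb]
    ring

end core

section main

variable {Ω : Type} [MeasurableSpace Ω] {μ : Measure Ω} [IsProbabilityMeasure μ]
  {κ : Measure Bool} [IsProbabilityMeasure κ] {N k : ℕ}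

/-- Any event and finite-valued random variable admit a conditional law. -/
lemma exists_cond_law [NeZero N] (S : Set Ω) (Y : Ω → Fin N)
    (hY : Measurable Y) :
    ∃ p : PMF (Fin N), ∀ w, μ {ω | ω ∈ S ∧ Y ω = w} = μ S * p w := by
  by_cases h0 : μ S = 0
  · refine ⟨PMF.pure 0, fun w => ?_⟩
    rw [h0, zero_mul]
    exact measure_mono_null (fun ω h => h.1) h0
  · have hp : IsProbabilityMeasure ((μ S)⁻¹ • μ.restrict S) := by
      constructor
      simp [ENNReal.inv_mul_cancel h0 (measure_ne_top μ S)]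
    have hp' : IsProbabilityMeasure (((μ S)⁻¹ • μ.restrict S).map Y) :=
      Measure.isProbabilityMeasure_map hY.aemeasurable
    refine ⟨(((μ S)⁻¹ • μ.restrict S).map Y).toPMF, fun w => ?_⟩
    rw [Measure.toPMF_apply, Measure.map_apply hY (measurableSet_singleton w),
      Measure.smul_apply, Measure.restrict_apply (hY (measurableSet_singleton w)), smul_eq_mul,
      ← mul_assoc, ENNReal.mul_inv_cancel h0 (measure_ne_top μ S), one_mul, Set.inter_comm]
    rfl

/-- Avoidance property of one path of the restarted process. -/
def PathAvoid (z : ℕ → Fin k → Fin N) : Prop :=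
  (∀ u i j, i ≠ j → z u i ≠ z u j) ∧ ∀ u i j, j < i → z (u + 1) j ≠ z u i

lemma comb_walk {Z : Bool → ℕ → Ω → Fin k → Fin N} (hZ : ∀ b u, Measurable (Z b u))
    {sd : Fin N → Bool} (hsd : ∀ b u ω j, sd (Z b u ω j) = b) {nb : Bool → ENNReal}
    (hnb : ∀ b, κ {b} * nb b = (N : ENNReal)⁻¹) (j : Fin k)
    (hw : ∀ b T (v : ℕ → Fin N), sd (v T) = b →
      μ {ω | (∀ u < T, Z b u ω j = v u) ∧ Z b T ω j = v T} =
        μ {ω | ∀ u < T, Z b u ω j = v u} * nb b) :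
    IsWalkLooped (Measure.infinitePi (fun _ : ℕ => κ.prod μ)) (fun t ω => comb Z t ω j) := by
  intro t v
  have hale := age_le (fun s => sd (v s)) (t + 1)
  obtain ⟨R, h1, h2⟩ := step (μ := μ) (κ := κ) hZ (fun s => sd (v s)) (fun s => {x | x j = v s}) t
    (fun s _ b u ω h => by rw [← hsd b u ω j, show Z b u ω j = v s from h]) (sd (v (t + 1)))
    _ _ rfl rfl rfl
  have h3 := h2 {x | x j = v (t + 1)}
    (fun b u ω h => by rw [← hsd b u ω j, show Z b u ω j = v _ from h])
  set a := age (fun s => sd (v s)) (t + 1) with ha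
  have h4 := hw (sd (v (t + 1))) a (fun u => v (t + 1 - a + u))
    (by rw [show t + 1 - a + a = t + 1 by omega])
  rw [show t + 1 - a + a = t + 1 by omega] at h4
  simp only [Set.mem_ofPred_eq] at h1 h3
  rw [h4] at h3
  rw [h1, ← hnb (sd (v (t + 1)))]
  calc _ = _ := by
        congr 1
        ext ω
        simp only [Set.mem_ofPred_eq]
        constructor
        · intro h
          exact ⟨fun s hs => h s (by omega), h _ le_rfl⟩
        · rintro ⟨h, h'⟩ s hs
          rcases Nat.lt_or_ge t s with h6 | h6
          · obtain rfl : s = t + 1 := by omega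
            exact h'
          · exact h s h6
    _ = _ := h3
    _ = _ := by ring

lemma comb_avoid {Z : Bool → ℕ → Ω → Fin k → Fin N}
    {sd : Fin N → Bool} (hsd : ∀ b u ω j, sd (Z b u ω j) = b)
    (hav : ∀ b, ∀ᵐ ω ∂μ, PathAvoid (fun u => Z b u ω)) :
    AvoidsAE (Measure.infinitePi (fun _ : ℕ => κ.prod μ)) (fun j t ω => comb Z t ω j) := by
  have h1 : ∀ᵐ ω ∂(Measure.infinitePi (fun _ : ℕ => κ.prod μ)),
      ∀ s : ℕ, ∀ b : Bool, PathAvoid (fun u => Z b u (ω s).2) := by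
    rw [ae_all_iff]
    intro s
    rw [ae_all_iff]
    intro b
    have h2 := (measurePreserving_eval_infinitePi (fun _ : ℕ => κ.prod μ) s).quasiMeasurePreserving
    have h3 : Measure.QuasiMeasurePreserving (Prod.snd : Bool × Ω → Ω) (κ.prod μ) μ :=
      Measure.quasiMeasurePreserving_snd
    exact (h3.comp h2).ae (hav b)
  filter_upwards [h1] with ω h
  refine ⟨fun i j hij => (h _ _).1 _ i j hij, fun t i j => ⟨fun hij => ?_, fun hij => ?_⟩⟩
  · exact (h _ _).1 _ j i hij.ne'
  · by_cases hc : (ω (t + 1)).1 = (ω t).1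
    · have ha : age (fun s => (ω s).1) (t + 1) = age (fun s => (ω s).1) t + 1 := by
        simp [age, hc]
      have hle := age_le (fun s => (ω s).1) t
      simp only [comb]
      rw [ha, hc, show t + 1 - (age (fun s => (ω s).1) t + 1) = t - age (fun s => (ω s).1) t by
        omega]
      exact (h _ _).2 _ i j hij
    · intro he
      apply hc
      have := congrArg sd he
      simpa only [comb, hsd] using this

lemma comb_markov [NeZero N] {Z : Bool → ℕ → Ω → Fin k → Fin N}
    (hZ : ∀ b u, Measurable (Z b u)) (hk : 1 ≤ k)
    {sd : Fin N → Bool} (hsd : ∀ b u ω j, sd (Z b u ω j) = b)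
    (hm : ∀ b (j : Fin k) (x : Fin k → Fin N), ∃ p : PMF (Fin N),
      ∀ T (v : Fin k → ℕ → Fin N) w, x = (fun i => if i < j then v i (T + 1) else v i T) →
      μ {ω | ((∀ u ≤ T, ∀ i, Z b u ω i = v i u) ∧ ∀ i < j, Z b (T + 1) ω i = v i (T + 1)) ∧
          Z b (T + 1) ω j = w} =
        μ {ω | (∀ u ≤ T, ∀ i, Z b u ω i = v i u) ∧ ∀ i < j, Z b (T + 1) ω i = v i (T + 1)} *
          p w) :
    IsMarkovianCoupling (Measure.infinitePi (fun _ : ℕ => κ.prod μ))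
      (fun j t ω => comb Z t ω j) := by
  have hf : ∀ b (j : Fin k) (x : Fin k → Fin N), ∃ p : PMF (Fin N), ∀ w,
      μ {ω | (∀ i < j, Z b 0 ω i = x i) ∧ Z b 0 ω j = w} =
        μ {ω | ∀ i < j, Z b 0 ω i = x i} * p w := fun b j x =>
    exists_cond_law _ _ ((measurable_pi_apply j).comp (hZ b 0))
  choose pc hpc using hm
  choose pf hpf using hf
  -- the combined kernel on side `b`
  let p : Bool → Bool → (j : Fin k) → (Fin k → Fin N) → PMF (Fin N) :=
    fun b c j x => if c then pc b j x else pf b j x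
  have hp : ∀ b (j : Fin k) (t a s0 : ℕ) (v : Fin k → ℕ → Fin N) (w : Fin N) (c : Bool),
      s0 + a = t + 1 → (c = true ↔ 0 < a) →
      μ {ω | (∀ u < a, ∀ i, Z b u ω i = v i (s0 + u)) ∧
          ((∀ i < j, Z b a ω i = v i (t + 1)) ∧ Z b a ω j = w)} =
        μ {ω | (∀ u < a, ∀ i, Z b u ω i = v i (s0 + u)) ∧
          (∀ i < j, Z b a ω i = v i (t + 1))} *
          p b c j (fun i => if i < j then v i (t + 1) else v i t) w := by
    intro b j t a s0 v w c hs hc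
    rcases a with _ | a
    · have hc' : c = false := by simpa using hc
      have := hpf b j (fun i => if i < j then v i (t + 1) else v i t) w
      have e : ∀ ω, (∀ i < j, Z b 0 ω i = if i < j then v i (t + 1) else v i t) ↔
          (∀ i < j, Z b 0 ω i = v i (t + 1)) := fun ω =>
        forall_congr' fun i => forall_congr' fun hi => by rw [if_pos hi]
      simp only [e] at this
      simpa [p, hc'] using this
    · have hc' : c = true := by simpa using hc
      have := hpc b j (fun i => if i < j then v i (t + 1) else v i t) a
        (fun i u => v i (s0 + u)) w (by
          rw [show s0 + (a + 1) = t + 1 by omega, show s0 + a = t by omega])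
      simp only [show s0 + (a + 1) = t + 1 by omega] at this
      simpa [p, hc', Nat.lt_succ_iff, and_assoc] using this
  let z0 : Fin k := ⟨0, hk⟩
  have hz0 : ∀ i : Fin k, ¬ i < z0 := fun i h => Nat.not_lt_zero _ h
  refine ⟨fun j x => if j = z0 then κ.toPMF.bind (fun b => p b (b == sd (x j)) j x)
    else p (sd (x z0)) (sd (x z0) == sd (x j)) j x, ?_⟩
  intro t j v w
  -- inconsistent histories
  by_cases hcons : ∃ i, sd (v i t) ≠ sd (v z0 t)
  · obtain ⟨i, hi⟩ := hcons
    have hemp : ∀ ω, ¬ (∀ i : Fin k, ∀ s ≤ t, comb Z s ω i = v i s) := by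
      intro ω h
      apply hi
      rw [← h i t le_rfl, ← h z0 t le_rfl]
      simp only [comb, hsd]
    simp [hemp]
  push Not at hcons
  let P := Measure.infinitePi (fun _ : ℕ => κ.prod μ)
  have key : ∀ b : Bool, ∃ R : ENNReal, ∃ a s0 : ℕ, s0 + a = t + 1 ∧
      ((b == sd (v j t)) = true ↔ 0 < a) ∧
      P {ω | ∀ s ≤ t, ∀ i, comb Z s ω i = v i s} =
        R * μ {ω | ∀ u < a, ∀ i, Z b u ω i = v i (s0 + u)} ∧
      ∀ D' : Set (Fin k → Fin N), (∀ b' u ω, Z b' u ω ∈ D' → b' = b) →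
        P {ω | (∀ s ≤ t, ∀ i, comb Z s ω i = v i s) ∧ comb Z (t + 1) ω ∈ D'} =
          R * κ {b} * μ {ω | (∀ u < a, ∀ i, Z b u ω i = v i (s0 + u)) ∧ Z b a ω ∈ D'} := by
    intro b
    let d : ℕ → Bool := fun s => if s = t + 1 then b else sd (v z0 s)
    have hd1 : d (t + 1) = b := by simp [d]
    have hd2 : ∀ s ≤ t, d s = sd (v z0 s) := fun s hs => by
      simp only [d]; rw [if_neg (by omega)]
    obtain ⟨R, h1, h2⟩ := step (μ := μ) (κ := κ) hZ d (fun s => {x | ∀ i, x i = v i s}) t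
      (fun s hs b u ω h => by
        rw [hd2 s hs, ← hsd b u ω z0, show Z b u ω z0 = v z0 s from h z0]) b
      _ _ hd1.symm rfl rfl
    have hale := age_le d (t + 1)
    refine ⟨R, age d (t + 1), t + 1 - age d (t + 1), by omega, ?_, h1, h2⟩
    simp only [age, hd1, hd2 t le_rfl, beq_iff_eq, hcons j]
    split_ifs with h <;> simp [h]
  have comm : ∀ ω, (∀ i : Fin k, ∀ s ≤ t, comb Z s ω i = v i s) ↔
      (∀ s ≤ t, ∀ i, comb Z s ω i = v i s) := fun ω =>
    ⟨fun h s hs i => h i s hs, fun h i s hs => h s hs i⟩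
  simp only [comm]
  by_cases hj : j = z0
  · subst hj
    simp only [hz0, false_imp_iff, implies_true, and_true, if_true, if_false, PMF.bind_apply,
      tsum_fintype, Measure.toPMF_apply]
    have hb : ∀ b, P {ω | (∀ s ≤ t, ∀ i, comb Z s ω i = v i s) ∧
        comb Z (t + 1) ω ∈ {x | x z0 = w ∧ sd w = b}} =
        P {ω | ∀ s ≤ t, ∀ i, comb Z s ω i = v i s} *
          (κ {b} * p b (b == sd (v z0 t)) z0 (fun i => v i t) w) := by
      intro b
      obtain ⟨R, a, s0, hs, hc, h1, h2⟩ := key b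
      rw [h2 _ (fun b' u ω h => by rw [← h.2, ← h.1, hsd]), h1]
      have h3 := hp b z0 t a s0 v w _ hs hc
      simp only [hz0, false_imp_iff, implies_true, and_true, true_and, if_false] at h3
      have h4 : ∀ ω, (Z b a ω ∈ {x : Fin k → Fin N | x z0 = w ∧ sd w = b}) ↔ Z b a ω z0 = w :=
        fun ω => ⟨fun h => h.1, fun h => ⟨h, by rw [← h, hsd]⟩⟩
      simp only [h4, h3]
      ring
    rw [Finset.mul_sum]
    rw [← Finset.sum_congr rfl (fun b _ => hb b)]
    rw [Fintype.sum_bool]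
    rcases hsw : sd w with _ | _
    · simp [P]
    · simp [P]
  · have hj0 : z0 < j := by
      rcases Nat.eq_zero_or_pos j.val with h | h
      · exact absurd (Fin.ext h) hj
      · exact h
    obtain ⟨R, a, s0, hs, hc, h1, h2⟩ := key (sd (v z0 (t + 1)))
    have h3 := hp (sd (v z0 (t + 1))) j t a s0 v w _ hs hc
    have h4 := h2 {x | ∀ i < j, x i = v i (t + 1)}
      (fun b' u ω h => by rw [← hsd b' u ω z0, show Z b' u ω z0 = _ from h z0 hj0])
    have h5 := h2 {x | (∀ i < j, x i = v i (t + 1)) ∧ x j = w}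
      (fun b' u ω h => by rw [← hsd b' u ω z0, show Z b' u ω z0 = _ from h.1 z0 hj0])
    simp only [Set.mem_ofPred_eq] at h4 h5
    simp only [hj, if_false, hj0, if_true, lt_irrefl, and_assoc]
    change P _ = P _ * _
    rw [h4, h5, h3]
    ring

end main

section emb

variable {Ω Ω₁ : Type} [MeasurableSpace Ω] [MeasurableSpace Ω₁] {μ : Measure Ω} {ν : Measure Ω₁}
  {N n k : ℕ}

lemma measure_fiber {β : Type} [Fintype β] [MeasurableSpace β] [MeasurableSingletonClass β]
    (S : Set Ω₁) (Y : Ω₁ → β) (hY : Measurable Y) :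
    ν S = ∑ x, ν {ω | ω ∈ S ∧ Y ω = x} := by
  have h := sum_measure_preimage_singleton (μ := ν.restrict S) (Finset.univ : Finset β) (f := Y)
    (fun y _ => hY (measurableSet_singleton y))
  simp only [Finset.coe_univ, Set.preimage_univ, Measure.restrict_apply_univ] at h
  rw [← h]
  refine Finset.sum_congr rfl fun x _ => ?_
  rw [Measure.restrict_apply (hY (measurableSet_singleton x)), Set.inter_comm]
  rfl

lemma walk_shift_s14 {X : ℕ → Ω₁ → Fin n} (hX : ∀ t, Measurable (X t)) (hw : IsWalkLooped ν X)
    (T : ℕ) (v : ℕ → Fin n) :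
    ν {ω | (∀ u < T, X (u + 1) ω = v u) ∧ X (T + 1) ω = v T} =
      ν {ω | ∀ u < T, X (u + 1) ω = v u} * (n : ENNReal)⁻¹ := by
  rw [measure_fiber _ (X 0) (hX 0), measure_fiber {ω | ∀ u < T, X (u + 1) ω = v u} (X 0) (hX 0),
    Finset.sum_mul]
  refine Finset.sum_congr rfl fun x _ => ?_
  have h := hw T (fun s => if s = 0 then x else v (s - 1))
  convert h using 2
  · ext ω
    simp only [Set.mem_ofPred_eq]
    constructor
    · rintro ⟨⟨h1, h2⟩, h3⟩ s hs
      rcases s with _ | s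
      · simpa using h3
      · rcases Nat.lt_or_ge s T with h4 | h4
        · simpa using h1 s h4
        · obtain rfl : s = T := by omega
          simpa using h2
    · intro h
      refine ⟨⟨fun u hu => by simpa using h (u + 1) (by omega), ?_⟩, ?_⟩
      · simpa using h (T + 1) le_rfl
      · simpa using h 0 (by omega)
  · congr 1
    ext ω
    simp only [Set.mem_ofPred_eq]
    constructor
    · rintro ⟨h1, h3⟩ s hs
      rcases s with _ | s
      · simpa using h3
      · simpa using h1 s (by omega)
    · intro h
      exact ⟨fun u hu => by simpa using h (u + 1) (by omega), by simpa using h 0 (by omega)⟩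

lemma markov_shift {X : Fin k → ℕ → Ω₁ → Fin n} (hX : ∀ j t, Measurable (X j t))
    {f : Fin k → (Fin k → Fin n) → PMF (Fin n)}
    (hf : ∀ (t : ℕ) (j : Fin k) (v : Fin k → ℕ → Fin n) (w : Fin n),
      ν {ω | ((∀ i : Fin k, ∀ s ≤ t, X i s ω = v i s) ∧
              (∀ i < j, X i (t + 1) ω = v i (t + 1))) ∧ X j (t + 1) ω = w} =
        ν {ω | (∀ i : Fin k, ∀ s ≤ t, X i s ω = v i s) ∧
               (∀ i < j, X i (t + 1) ω = v i (t + 1))} *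
          f j (fun i => if i < j then v i (t + 1) else v i t) w)
    (T : ℕ) (j : Fin k) (v : Fin k → ℕ → Fin n) (w : Fin n) :
    ν {ω | ((∀ u ≤ T, ∀ i, X i (u + 1) ω = v i u) ∧
            (∀ i < j, X i (T + 2) ω = v i (T + 1))) ∧ X j (T + 2) ω = w} =
      ν {ω | (∀ u ≤ T, ∀ i, X i (u + 1) ω = v i u) ∧
             (∀ i < j, X i (T + 2) ω = v i (T + 1))} *
        f j (fun i => if i < j then v i (T + 1) else v i T) w := by
  have hY : Measurable (fun ω i => X i 0 ω) := measurable_pi_lambda _ fun i => hX i 0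
  rw [measure_fiber _ _ hY, measure_fiber {ω | (∀ u ≤ T, ∀ i, X i (u + 1) ω = v i u) ∧
             (∀ i < j, X i (T + 2) ω = v i (T + 1))} _ hY,
    Finset.sum_mul]
  refine Finset.sum_congr rfl fun x _ => ?_
  have h := hf (T + 1) j (fun i s => if s = 0 then x i else v i (s - 1)) w
  have e : ∀ ω, (∀ i : Fin k, ∀ s ≤ T + 1, X i s ω = if s = 0 then x i else v i (s - 1)) ↔
      ((∀ u ≤ T, ∀ i, X i (u + 1) ω = v i u) ∧ (fun i => X i 0 ω) = x) := by
    intro ω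
    constructor
    · intro h
      refine ⟨fun u hu i => by simpa using h i (u + 1) (by omega), ?_⟩
      funext i
      simpa using h i 0 (by omega)
    · rintro ⟨h1, h2⟩ i s hs
      rcases s with _ | s
      · simpa using congrFun h2 i
      · simpa using h1 s (by omega) i
  simp only [e] at h
  simp only [Nat.add_eq_zero_iff, one_ne_zero, and_false, if_false, Nat.add_sub_cancel] at h
  convert h using 2
  · ext ω; simp only [Set.mem_ofPred_eq]; tauto
  · congr 1
    ext ω; simp only [Set.mem_ofPred_eq]; tauto

variable (φ : Ω → Ω₁) (e : Fin n → Fin N)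

/-- the shifted, embedded and pulled back coupling -/
def emb (X : Fin k → ℕ → Ω₁ → Fin n) (u : ℕ) (ω : Ω) (i : Fin k) : Fin N :=
  e (X i (u + 1) (φ ω))

lemma measurable_emb {φ : Ω → Ω₁} (hφ : Measurable φ) {X : Fin k → ℕ → Ω₁ → Fin n}
    (hX : ∀ j t, Measurable (X j t)) (u : ℕ) : Measurable (emb φ e X u) :=
  measurable_pi_lambda _ fun i =>
    (Measurable.of_discrete (f := e)).comp ((hX i (u + 1)).comp hφ)

lemma emb_avoid {φ : Ω → Ω₁} (hφ : MeasurePreserving φ μ ν) {e : Fin n → Fin N}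
    (he : Function.Injective e) {X : Fin k → ℕ → Ω₁ → Fin n} (hav : AvoidsAE ν X) :
    ∀ᵐ ω ∂μ, PathAvoid (fun u => emb φ e X u ω) := by
  filter_upwards [hφ.quasiMeasurePreserving.ae hav] with ω h
  refine ⟨fun u i j hij heq => ?_, fun u i j hij heq => ?_⟩
  · have heq := he heq
    rcases lt_or_gt_of_ne hij with h1 | h1
    · exact (h.2 u i j).1 h1 heq.symm
    · exact (h.2 u j i).1 h1 heq
  · exact (h.2 (u + 1) i j).2 hij (he heq)

lemma emb_walk {φ : Ω → Ω₁} (hφ : MeasurePreserving φ μ ν) {e : Fin n → Fin N}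
    (he : Function.Injective e) {X : Fin k → ℕ → Ω₁ → Fin n} (hX : ∀ j t, Measurable (X j t))
    (j : Fin k) (hw : IsWalkLooped ν (X j)) (T : ℕ) (v : ℕ → Fin N) (hv : v T ∈ Set.range e) :
    μ {ω | (∀ u < T, emb φ e X u ω j = v u) ∧ emb φ e X T ω j = v T} =
      μ {ω | ∀ u < T, emb φ e X u ω j = v u} * (n : ENNReal)⁻¹ := by
  by_cases hr : ∀ u ≤ T, v u ∈ Set.range e
  · obtain ⟨y0, _⟩ := hv
    have hr' : ∀ u, ∃ y, u ≤ T → e y = v u := fun u => by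
      by_cases hu : u ≤ T
      · obtain ⟨y, hy⟩ := hr u hu
        exact ⟨y, fun _ => hy⟩
      · exact ⟨y0, fun h => absurd h hu⟩
    choose v' hv' using hr'
    have h := walk_shift_s14 (hX j) hw T v'
    have m1 : ∀ u y, MeasurableSet {ω | X j u ω = y} := fun u y =>
      hX j u (measurableSet_singleton y)
    have m2 : MeasurableSet {ω | ∀ u < T, X j (u + 1) ω = v' u} := by
      have : {ω | ∀ u < T, X j (u + 1) ω = v' u} =
        ⋂ u : ℕ, ⋂ _ : u < T, {ω | X j (u + 1) ω = v' u} := by ext ω; simp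
      rw [this]
      exact MeasurableSet.iInter fun u => MeasurableSet.iInter fun _ => m1 _ _
    have m3 : MeasurableSet {ω | (∀ u < T, X j (u + 1) ω = v' u) ∧ X j (T + 1) ω = v' T} :=
      m2.inter (m1 _ _)
    rw [← hφ.measure_preimage m2.nullMeasurableSet, ← hφ.measure_preimage m3.nullMeasurableSet]
      at h
    have q : ∀ u ≤ T, ∀ ω, (emb φ e X u ω j = v u ↔ X j (u + 1) (φ ω) = v' u) := by
      intro u hu ω
      rw [← hv' u hu]
      exact he.eq_iff
    have q2 : ∀ ω, (∀ u < T, emb φ e X u ω j = v u) ↔ ∀ u < T, X j (u + 1) (φ ω) = v' u :=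
      fun ω => forall_congr' fun u => forall_congr' fun hu => q u hu.le ω
    simp only [q2, q T le_rfl]
    exact h
  · push Not at hr
    obtain ⟨u, hu, hne⟩ := hr
    have hlt : u < T := lt_of_le_of_ne hu (fun h => hne (h ▸ hv))
    have : ∀ ω, ¬ (∀ u < T, emb φ e X u ω j = v u) := fun ω h => hne ⟨_, h u hlt⟩
    simp [this]

lemma emb_markov [NeZero N] {φ : Ω → Ω₁} (hφ : MeasurePreserving φ μ ν) {e : Fin n → Fin N}
    (he : Function.Injective e) {X : Fin k → ℕ → Ω₁ → Fin n} (hX : ∀ j t, Measurable (X j t))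
    (hm : IsMarkovianCoupling ν X) (j : Fin k) (x : Fin k → Fin N) : ∃ p : PMF (Fin N),
      ∀ T (v : Fin k → ℕ → Fin N) w, x = (fun i => if i < j then v i (T + 1) else v i T) →
      μ {ω | ((∀ u ≤ T, ∀ i, emb φ e X u ω i = v i u) ∧
          ∀ i < j, emb φ e X (T + 1) ω i = v i (T + 1)) ∧ emb φ e X (T + 1) ω j = w} =
        μ {ω | (∀ u ≤ T, ∀ i, emb φ e X u ω i = v i u) ∧
          ∀ i < j, emb φ e X (T + 1) ω i = v i (T + 1)} * p w := by
  obtain ⟨f, hf⟩ := hm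
  by_cases hx : ∀ i, x i ∈ Set.range e
  · choose x' hx' using hx
    refine ⟨(f j x').map e, ?_⟩
    intro T v w hxv
    by_cases hr : ∀ i, ∀ u ≤ T, v i u ∈ Set.range e
    · have hr' : ∀ i u, ∃ y, (u ≤ T → e y = v i u) ∧ (u = T + 1 → i < j → e y = v i u) := by
        intro i u
        by_cases hu : u ≤ T
        · obtain ⟨y, hy⟩ := hr i u hu
          exact ⟨y, fun _ => hy, fun h => by omega⟩
        · refine ⟨x' i, fun h => absurd h hu, ?_⟩
          rintro rfl hij
          rw [hx' i, hxv]
          simp [hij]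
      choose v' hv1 hv2 using hr'
      have hxv' : x' = fun i => if i < j then v' i (T + 1) else v' i T := by
        funext i
        apply he
        rw [hx', hxv]
        simp only
        split_ifs with hij
        · rw [hv2 i _ rfl hij]
        · rw [hv1 i _ le_rfl]
      have q : ∀ i, ∀ u ≤ T, ∀ ω, (emb φ e X u ω i = v i u ↔ X i (u + 1) (φ ω) = v' i u) := by
        intro i u hu ω
        rw [← hv1 i u hu]
        exact he.eq_iff
      have q1 : ∀ ω, (∀ u ≤ T, ∀ i, emb φ e X u ω i = v i u) ↔
          ∀ u ≤ T, ∀ i, X i (u + 1) (φ ω) = v' i u :=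
        fun ω => forall_congr' fun u => forall_congr' fun hu => forall_congr' fun i => q i u hu ω
      have q2 : ∀ ω, (∀ i < j, emb φ e X (T + 1) ω i = v i (T + 1)) ↔
          ∀ i < j, X i (T + 2) (φ ω) = v' i (T + 1) :=
        fun ω => forall_congr' fun i => forall_congr' fun hi => by
          rw [← hv2 i _ rfl hi]
          exact he.eq_iff
      simp only [q1, q2]
      have m1 : ∀ i u y, MeasurableSet {ω | X i u ω = y} := fun i u y =>
        hX i u (measurableSet_singleton y)
      have m2 : MeasurableSet {ω | (∀ u ≤ T, ∀ i, X i (u + 1) ω = v' i u) ∧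
          (∀ i < j, X i (T + 2) ω = v' i (T + 1))} := by
        have : {ω | (∀ u ≤ T, ∀ i, X i (u + 1) ω = v' i u) ∧
          (∀ i < j, X i (T + 2) ω = v' i (T + 1))} =
          (⋂ u : ℕ, ⋂ _ : u ≤ T, ⋂ i, {ω | X i (u + 1) ω = v' i u}) ∩
            ⋂ i, ⋂ _ : i < j, {ω | X i (T + 2) ω = v' i (T + 1)} := by ext ω; simp
        rw [this]
        exact (MeasurableSet.iInter fun u => MeasurableSet.iInter fun _ =>
          MeasurableSet.iInter fun i => m1 _ _ _).inter
          (MeasurableSet.iInter fun u => MeasurableSet.iInter fun _ => m1 _ _ _)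
      by_cases hw : w ∈ Set.range e
      · obtain ⟨w', rfl⟩ := hw
        have h := markov_shift hX hf T j v' w'
        have m3 : MeasurableSet {ω | ((∀ u ≤ T, ∀ i, X i (u + 1) ω = v' i u) ∧
          (∀ i < j, X i (T + 2) ω = v' i (T + 1))) ∧ X j (T + 2) ω = w'} :=
          m2.inter (m1 _ _ _)
        rw [← hφ.measure_preimage m2.nullMeasurableSet,
          ← hφ.measure_preimage m3.nullMeasurableSet, ← hxv'] at h
        have hmap : (PMF.map e (f j x')) (e w') = f j x' w' := by
          rw [PMF.map_apply]
          simp [he.eq_iff]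
        rw [hmap]
        have q3 : ∀ ω, emb φ e X (T + 1) ω j = e w' ↔ X j (T + 2) (φ ω) = w' :=
          fun ω => he.eq_iff
        simp only [q3]
        exact h
      · have hmap : (PMF.map e (f j x')) w = 0 := by
          rw [PMF.map_apply]
          simp only [ENNReal.tsum_eq_zero, ite_eq_right_iff]
          intro y hy
          exact absurd ⟨y, hy.symm⟩ hw
        have : ∀ ω, ¬ (emb φ e X (T + 1) ω j = w) := fun ω h => hw ⟨_, h⟩
        simp [this, hmap]
    · push Not at hr
      obtain ⟨i, u, hu, hne⟩ := hr
      have : ∀ ω, ¬ (∀ u ≤ T, ∀ i, emb φ e X u ω i = v i u) := fun ω h => hne ⟨_, h u hu i⟩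
      simp [this]
  · push Not at hx
    obtain ⟨i, hi⟩ := hx
    refine ⟨PMF.pure 0, ?_⟩
    intro T v w hxv
    have : ∀ ω, ¬ ((∀ u ≤ T, ∀ i, emb φ e X u ω i = v i u) ∧
          ∀ i < j, emb φ e X (T + 1) ω i = v i (T + 1)) := by
      rintro ω ⟨h1, h2⟩
      apply hi
      rw [hxv]
      simp only
      split_ifs with hij
      · exact ⟨_, h2 i hij⟩
      · exact ⟨_, h1 T le_rfl i⟩
    simp [this]

end emb

/-- the coin -/
noncomputable def coin (m n : ℕ) : Measure Bool :=
  ((m : ENNReal) * ((m + n : ℕ) : ENNReal)⁻¹) • Measure.dirac true +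
    ((n : ENNReal) * ((m + n : ℕ) : ENNReal)⁻¹) • Measure.dirac false

lemma coin_prob (m n : ℕ) (hm : 2 ≤ m) : IsProbabilityMeasure (coin m n) := by
  constructor
  simp only [coin, Measure.add_apply, Measure.smul_apply, measure_univ, smul_eq_mul, mul_one]
  rw [← add_mul, ← Nat.cast_add]
  exact ENNReal.mul_inv_cancel (by simp; omega) (ENNReal.natCast_ne_top _)

lemma coin_mul (m n : ℕ) (hm : 2 ≤ m) (hn : 2 ≤ n) (b : Bool) :
    coin m n {b} * (if b then (m : ENNReal)⁻¹ else (n : ENNReal)⁻¹) =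
      ((m + n : ℕ) : ENNReal)⁻¹ := by
  have h1 : (m : ENNReal) * (m : ENNReal)⁻¹ = 1 :=
    ENNReal.mul_inv_cancel (by simp; omega) (ENNReal.natCast_ne_top _)
  have h2 : (n : ENNReal) * (n : ENNReal)⁻¹ = 1 :=
    ENNReal.mul_inv_cancel (by simp; omega) (ENNReal.natCast_ne_top _)
  rcases b with _ | _
  · simp only [coin, Measure.add_apply, Measure.smul_apply, smul_eq_mul]
    simp only [measurableSet_singleton, Measure.dirac_apply', Set.indicator, Set.mem_singleton_iff]
    simp only [Pi.one_apply, reduceCtorEq, if_false, if_true, mul_zero, zero_add, mul_one]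
    rw [mul_right_comm, h2, one_mul]
  · simp only [coin, Measure.add_apply, Measure.smul_apply, smul_eq_mul]
    simp only [measurableSet_singleton, Measure.dirac_apply', Set.indicator, Set.mem_singleton_iff]
    simp only [Pi.one_apply, reduceCtorEq, if_false, if_true, mul_zero, add_zero, mul_one]
    rw [mul_right_comm, h1, one_mul]

lemma main (m n k : ℕ) (hm : 2 ≤ m) (hn : 2 ≤ n) (hk : 1 ≤ k)
    {ΩA ΩB : Type} [MeasurableSpace ΩA] [MeasurableSpace ΩB] (μA : Measure ΩA) (μB : Measure ΩB)
    [IsProbabilityMeasure μA] [IsProbabilityMeasure μB]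
    (A : Fin k → ℕ → ΩA → Fin m) (B : Fin k → ℕ → ΩB → Fin n)
    (hA : ∀ j t, Measurable (A j t)) (hB : ∀ j t, Measurable (B j t))
    (wA : ∀ j, IsWalkLooped μA (A j)) (wB : ∀ j, IsWalkLooped μB (B j))
    (aA : AvoidsAE μA A) (aB : AvoidsAE μB B) :
    ∃ (Ω : Type) (_ : MeasurableSpace Ω) (μ : Measure Ω)
      (X : Fin k → ℕ → Ω → Fin (m + n)),
      IsProbabilityMeasure μ ∧ (∀ j t, Measurable (X j t)) ∧
      (∀ j, IsWalkLooped μ (X j)) ∧ AvoidsAE μ X ∧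
      (IsMarkovianCoupling μA A → IsMarkovianCoupling μB B → IsMarkovianCoupling μ X) := by
  have : NeZero (m + n) := ⟨by omega⟩
  have := coin_prob m n hm
  let e : Fin m → Fin (m + n) := Fin.castAdd n
  let e' : Fin n → Fin (m + n) := Fin.natAdd m
  have he : Function.Injective e := Fin.castAdd_injective m n
  have he' : Function.Injective e' := Fin.natAdd_injective n m
  have hφ : MeasurePreserving (Prod.fst : ΩA × ΩB → ΩA) (μA.prod μB) μA :=
    measurePreserving_fst
  have hψ : MeasurePreserving (Prod.snd : ΩA × ΩB → ΩB) (μA.prod μB) μB :=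
    measurePreserving_snd
  let Z : Bool → ℕ → ΩA × ΩB → Fin k → Fin (m + n) := fun b =>
    if b then emb Prod.fst e A else emb Prod.snd e' B
  have hZ : ∀ b u, Measurable (Z b u) := by
    intro b u
    rcases b with _ | _
    · exact measurable_emb e' measurable_snd hB u
    · exact measurable_emb e measurable_fst hA u
  let sd : Fin (m + n) → Bool := fun x => decide (x.val < m)
  have hsd : ∀ b u ω j, sd (Z b u ω j) = b := by
    intro b u ω j
    rcases b with _ | _
    · simp [Z, sd, emb, e']
    · simp [Z, sd, emb, e]
  refine ⟨ℕ → Bool × (ΩA × ΩB), inferInstance,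
    Measure.infinitePi (fun _ : ℕ => (coin m n).prod (μA.prod μB)),
    fun j t ω => comb Z t ω j, inferInstance, ?_, ?_, ?_, ?_⟩
  · intro j t
    exact (measurable_pi_apply j).comp (measurable_comb hZ t)
  · intro j
    refine comb_walk hZ hsd (coin_mul m n hm hn) j ?_
    intro b T v hv
    rcases b with _ | _
    · refine emb_walk hψ he' hB j (wB j) T v ?_
      have hv' : ¬ (v T).val < m := by simpa [sd] using hv
      exact ⟨⟨(v T).val - m, by omega⟩, by ext; simp [e']; omega⟩
    · refine emb_walk hφ he hA j (wA j) T v ?_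
      have hv' : (v T).val < m := by simpa [sd] using hv
      exact ⟨⟨(v T).val, hv'⟩, by ext; simp [e]⟩
  · refine comb_avoid hsd ?_
    intro b
    rcases b with _ | _
    · exact emb_avoid hψ he' aB
    · exact emb_avoid hφ he aA
  · intro mA mB
    refine comb_markov hZ hk hsd ?_
    intro b j x
    rcases b with _ | _
    · exact emb_markov hψ he' hB mB j x
    · exact emb_markov hφ he hA mA j x

end ACSum

/-- Sum lemma, looped case: from avoidance couplings of `k` walkers on `K_m^*`
and on `K_n^*` one obtains an avoidance coupling of `k` walkers on
`K_{m+n}^*`; moreover, if the given couplings are Markovian then so is the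
resulting one. -/
theorem avoidance_coupling_looped_sum (m n k : ℕ)
    (hm : 2 ≤ m) (hn : 2 ≤ n) (hk : 1 ≤ k) :
    (AvoidanceCouplingLooped m k → AvoidanceCouplingLooped n k →
      AvoidanceCouplingLooped (m + n) k) ∧
    (MarkovianAvoidanceCouplingLooped m k → MarkovianAvoidanceCouplingLooped n k →
      MarkovianAvoidanceCouplingLooped (m + n) k) := by
  constructor
  · rintro ⟨ΩA, iA, μA, A, pA, hA, wA, aA⟩ ⟨ΩB, iB, μB, B, pB, hB, wB, aB⟩
    obtain ⟨Ω, i, μ, X, h1, h2, h3, h4, -⟩ :=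
      ACSum.main m n k hm hn hk μA μB A B hA hB wA wB aA aB
    exact ⟨Ω, i, μ, X, h1, h2, h3, h4⟩
  · rintro ⟨ΩA, iA, μA, A, pA, hA, wA, aA, mA⟩ ⟨ΩB, iB, μB, B, pB, hB, wB, aB, mB⟩
    obtain ⟨Ω, i, μ, X, h1, h2, h3, h4, h5⟩ :=
      ACSum.main m n k hm hn hk μA μB A B hA hB wA wB aA aB
    exact ⟨Ω, i, μ, X, h1, h2, h3, h4, h5 mA mB⟩
end

section
/- For all integers n ≥ 2 and k ≥ 1 such that (k : ℝ) ≤ n / (8 · logb 2 n), there exists a Markovian avoidance coupling of k walkers on the looped complete graph K_n^* (here logb 2 n denotes the real logarithm of n in base 2). -/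
open MeasureTheory ProbabilityTheory

/-! ### Part 1: a Markov chain driven by i.i.d. noise -/

/-- The trajectory driven by the noise `ω`. -/
def trajAC {E C : Type} (g0 : E → C) (g : C → E → C) (ω : ℕ → E) : ℕ → C
  | 0 => g0 (ω 0)
  | t + 1 => g (trajAC g0 g ω t) (ω (t + 1))

lemma trajAC_congr {E C : Type} (g0 : E → C) (g : C → E → C) (ω ω' : ℕ → E) (t : ℕ)
    (h : ∀ s ≤ t, ω s = ω' s) : trajAC g0 g ω t = trajAC g0 g ω' t := by
  induction t with
  | zero => simp [trajAC, h 0 le_rfl]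
  | succ t ih =>
    simp only [trajAC]
    rw [ih (fun s hs => h s (by omega)), h (t + 1) le_rfl]

/-- `A` depends only on the noise up to time `t`. -/
def DepAC {E : Type} (t : ℕ) (A : Set (ℕ → E)) : Prop :=
  ∀ ω ω' : ℕ → E, (∀ s ≤ t, ω s = ω' s) → ω ∈ A → ω' ∈ A

lemma DepAC.exists_preimage {E : Type} {t : ℕ} {A : Set (ℕ → E)} (hA : DepAC t A) :
    ∃ A' : Set (Finset.range (t + 1) → E), A = (fun ω (i : Finset.range (t + 1)) => ω i) ⁻¹' A' := by
  refine ⟨(fun ω (i : Finset.range (t + 1)) => ω i) '' A, ?_⟩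
  ext ω
  constructor
  · intro h; exact ⟨ω, h, rfl⟩
  · rintro ⟨ω', h, h'⟩
    refine hA ω' ω (fun s hs => ?_) h
    exact congrFun h' ⟨s, by simpa using Nat.lt_succ_of_le hs⟩

set_option linter.unusedSectionVars false

section chain
variable {E : Type} [Fintype E] [MeasurableSpace E] [MeasurableSingletonClass E]

lemma DepAC.measurableSet {t : ℕ} {A : Set (ℕ → E)} (hA : DepAC t A) : MeasurableSet A := by
  obtain ⟨A', rfl⟩ := hA.exists_preimage
  exact (measurable_pi_lambda _ (fun i => measurable_pi_apply _)) (Set.toFinite A').measurableSet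

lemma DepAC.indep (ν : Measure E) [IsProbabilityMeasure ν] {t : ℕ} {A : Set (ℕ → E)}
    (hA : DepAC t A) (D : Set E) :
    Measure.infinitePi (fun _ : ℕ => ν) (A ∩ {ω | ω (t + 1) ∈ D}) =
      Measure.infinitePi (fun _ : ℕ => ν) A * ν D := by
  have hD : MeasurableSet D := (Set.toFinite D).measurableSet
  obtain ⟨A', rfl⟩ := hA.exists_preimage
  have h1 : iIndepFun (fun (i : ℕ) (ω : ℕ → E) => ω i) (Measure.infinitePi (fun _ : ℕ => ν)) :=
    iIndepFun_infinitePi (P := fun _ : ℕ => ν) (X := fun _ x => x) (fun _ => measurable_id)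
  have h2 := h1.indepFun_finset (Finset.range (t + 1)) {t + 1} (by simp) (fun i => measurable_pi_apply i)
  have h3 := h2.measure_inter_preimage_eq_mul A' ((fun f => f ⟨t + 1, by simp⟩) ⁻¹' D)
    (Set.toFinite A').measurableSet (measurable_pi_apply _ hD)
  have h4 : ν D = Measure.infinitePi (fun _ : ℕ => ν) ((fun ω => ω (t + 1)) ⁻¹' D) := by
    rw [(measurePreserving_eval_infinitePi (fun _ : ℕ => ν) (t + 1)).measure_preimage hD.nullMeasurableSet]
  rw [h4]
  exact h3

end chain

section chain2
variable {E : Type} [Fintype E] [MeasurableSpace E] [MeasurableSingletonClass E]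
variable {C : Type} [Fintype C] [DecidableEq C]

lemma depAC_inter {t : ℕ} {A A' : Set (ℕ → E)} (hA : DepAC t A) (hA' : DepAC t A') :
    DepAC t (A ∩ A') := fun ω ω' h hω => ⟨hA ω ω' h hω.1, hA' ω ω' h hω.2⟩

lemma depAC_mono {s t : ℕ} (hst : s ≤ t) {A : Set (ℕ → E)} (hA : DepAC s A) : DepAC t A :=
  fun ω ω' h hω => hA ω ω' (fun r hr => h r (hr.trans hst)) hω

lemma depAC_traj (g0 : E → C) (g : C → E → C) (t : ℕ) (P : C → Prop) :
    DepAC t {ω | P (trajAC g0 g ω t)} := by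
  intro ω ω' h hω
  simpa [trajAC_congr g0 g ω ω' t h] using hω

lemma measure_partition_AC (μ : Measure (ℕ → E)) (g0 : E → C) (g : C → E → C) (t : ℕ)
    (A : Set (ℕ → E)) (hA : MeasurableSet A) :
    μ A = ∑ x, μ (A ∩ {ω | trajAC g0 g ω t = x}) := by
  have h : A = ⋃ x ∈ (Finset.univ : Finset C), (A ∩ {ω | trajAC g0 g ω t = x}) := by
    ext ω; simp
  conv_lhs => rw [h]
  refine measure_biUnion_finset ?_ (fun x _ => hA.inter (depAC_traj g0 g t (· = x)).measurableSet)
  intro x _ y _ hxy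
  refine Set.disjoint_left.2 ?_
  rintro ω ⟨_, h1⟩ ⟨_, h2⟩
  exact hxy (h1.symm.trans h2)

lemma markov_sum_AC (ν : Measure E) [IsProbabilityMeasure ν] (g0 : E → C) (g : C → E → C) (t : ℕ)
    (A : Set (ℕ → E)) (hA : DepAC t A) (h : C → ENNReal) :
    ∑ y, Measure.infinitePi (fun _ : ℕ => ν) (A ∩ {ω | trajAC g0 g ω (t + 1) = y}) * h y =
    ∑ x, Measure.infinitePi (fun _ : ℕ => ν) (A ∩ {ω | trajAC g0 g ω t = x}) *
      ∑ y, ν {e | g x e = y} * h y := by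
  have key : ∀ x y, Measure.infinitePi (fun _ : ℕ => ν)
      (A ∩ {ω | trajAC g0 g ω (t + 1) = y} ∩ {ω | trajAC g0 g ω t = x}) =
      Measure.infinitePi (fun _ : ℕ => ν) (A ∩ {ω | trajAC g0 g ω t = x}) * ν {e | g x e = y} := by
    intro x y
    rw [← (depAC_inter hA (depAC_traj g0 g t (· = x))).indep ν]
    congr 1
    ext ω
    simp only [trajAC, Set.mem_inter_iff, Set.mem_ofPred_eq]
    constructor
    · rintro ⟨⟨a, b⟩, c⟩; subst c; exact ⟨⟨a, rfl⟩, b⟩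
    · rintro ⟨⟨a, b⟩, c⟩; subst b; exact ⟨⟨a, c⟩, rfl⟩
  have : ∀ y, Measure.infinitePi (fun _ : ℕ => ν) (A ∩ {ω | trajAC g0 g ω (t + 1) = y}) * h y
      = ∑ x, Measure.infinitePi (fun _ : ℕ => ν) (A ∩ {ω | trajAC g0 g ω t = x}) *
        (ν {e | g x e = y} * h y) := by
    intro y
    rw [measure_partition_AC _ g0 g t _ ((depAC_inter (depAC_mono (Nat.le_succ t) hA)
      (depAC_traj g0 g (t + 1) (· = y))).measurableSet), Finset.sum_mul]
    simp_rw [key, mul_assoc]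
  simp_rw [this, Finset.mul_sum]
  exact Finset.sum_comm

end chain2

/-! ### Part 2: the combinatorics of one round -/

section static
variable {V B : Type} [Fintype V] [DecidableEq V] [Fintype B] [DecidableEq B] {k : ℕ}

/-- A choice of a vertex in every block. -/
abbrev RAC (blk : V → B) : Type := ∀ b : B, {v : V // blk v = b}

open Classical in
/-- If some vertex satisfies `P`, apply `σ` to it; otherwise use the default `d`. -/
noncomputable def selAC (σ : Equiv.Perm V) (P : V → Prop) (d : V) : V :=
  if h : ∃ w, P w then σ h.choose else d

/-- `w` is the position, in block `b`, of a walker which moves after `j`. -/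
def parAC (blk : V → B) (x : Fin k → V) (j : Fin k) (b : B) : V → Prop :=
  fun w => blk w = b ∧ ∃ i, j < i ∧ x i = w

/-- Initial configuration. -/
def g0AC (blk : V → B) (q : V → Fin k → B) (e : V × RAC blk) : Fin k → V :=
  fun i => e.2 (q e.1 i)

/-- One round of the chain. -/
noncomputable def gAC (blk : V → B) (σ : Equiv.Perm V) (q : V → Fin k → B)
    (x : Fin k → V) (e : V × RAC blk) : Fin k → V :=
  fun j => selAC σ (parAC blk x j (q e.1 j)) (e.2 (q e.1 j))

variable (blk : V → B) (σ : Equiv.Perm V) (hσ : ∀ v, blk (σ v) = blk v) (q : V → Fin k → B)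

lemma valAC_congr (r : RAC blk) {b b' : B} (h : b = b') : (r b : V) = r b' := by
  rw [h]

lemma updAC_val (r : RAC blk) (b : B) (w : V) (hw : blk w = b) (z : V) (hz : blk z = b) :
    ((Function.update r b ⟨z, hz⟩ : RAC blk) (blk w) : V) = z := by
  subst hw; simp

lemma updAC_upd (r : RAC blk) (b : B) (w : V) (hw : blk w = b) (z : V) (hz : blk z = b) :
    (Function.update (Function.update r b ⟨z, hz⟩ : RAC blk) (blk w) ⟨w, rfl⟩ : RAC blk) =
      Function.update r b ⟨w, hw⟩ := by
  subst hw; simp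

lemma selAC_of_unique (P : V → Prop) (d w : V) (hw : P w) (hu : ∀ w', P w' → w' = w) :
    selAC σ P d = σ w := by
  have h : ∃ w, P w := ⟨w, hw⟩
  rw [selAC, dif_pos h, hu _ h.choose_spec]

lemma selAC_of_not (P : V → Prop) (d : V) (h : ¬ ∃ w, P w) : selAC σ P d = d := by
  rw [selAC, dif_neg h]

include hσ in
lemma blk_selAC (x : Fin k → V) (j : Fin k) (b : B) (d : V) (hd : blk d = b) :
    blk (selAC σ (parAC blk x j b) d) = b := by
  by_cases h : ∃ w, parAC blk x j b w
  · rw [selAC, dif_pos h, hσ]; exact h.choose_spec.1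
  · rw [selAC_of_not σ _ _ h, hd]

include hσ in
lemma blk_gAC (x : Fin k → V) (e : V × RAC blk) (j : Fin k) :
    blk (gAC blk σ q x e j) = q e.1 j :=
  blk_selAC blk σ hσ _ _ _ _ (e.2 _).2

lemma blk_g0AC (e : V × RAC blk) (j : Fin k) : blk (g0AC blk q e j) = q e.1 j := (e.2 _).2

lemma parAC_congr (x x' : Fin k → V) (j : Fin k) (h : ∀ i, j < i → x i = x' i) (b : B) :
    parAC blk x j b = parAC blk x' j b := by
  funext w
  refine propext (and_congr_right fun _ => exists_congr fun i => and_congr_right fun hi => ?_)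
  rw [h i hi]

lemma gAC_congr (x x' : Fin k → V) (j : Fin k) (h : ∀ i, j < i → x i = x' i) (e : V × RAC blk) :
    gAC blk σ q x e j = gAC blk σ q x' e j := by
  simp only [gAC, parAC_congr blk x x' j h]

/-- The permutation of a block induced by `σ`. -/
def sigAC (b : B) : Equiv.Perm {v : V // blk v = b} :=
  σ.subtypePerm (fun v => by rw [hσ])

open Classical in
/-- The exchange map on pairs of choices. -/
noncomputable def phiAC (S : Set B) : RAC blk × RAC blk ≃ RAC blk × RAC blk where
  toFun p := (fun b => if b ∈ S then p.2 b else p.1 b,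
    fun b => if b ∈ S then sigAC blk σ hσ b (p.1 b) else p.2 b)
  invFun p := (fun b => if b ∈ S then (sigAC blk σ hσ b).symm (p.2 b) else p.1 b,
    fun b => if b ∈ S then p.1 b else p.2 b)
  left_inv p := by
    refine Prod.ext ?_ ?_ <;> funext b <;> by_cases h : b ∈ S <;> simp [h]
  right_inv p := by
    refine Prod.ext ?_ ?_ <;> funext b <;> by_cases h : b ∈ S <;> simp [h]

include hσ in
lemma static_round (hq : ∀ u, Function.Injective (q u)) (j : Fin k) (v : V)
    (h : (Fin k → V) → ENNReal)
    (hh : ∀ x x', (∀ i, j ≤ i → x i = x' i) → h x = h x') :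
    ∑ e0, (if g0AC blk q e0 j = v then ∑ e, h (gAC blk σ q (g0AC blk q e0) e) else 0) =
    ∑ e0, (if g0AC blk q e0 j = v then ∑ e, h (g0AC blk q e) else 0) := by
  have main : ∀ u u' : V, ∑ r : RAC blk, ∑ r' : RAC blk,
      (if g0AC blk q (u, r) j = v then h (gAC blk σ q (g0AC blk q (u, r)) (u', r')) else 0) =
      ∑ r : RAC blk, ∑ r' : RAC blk,
      (if g0AC blk q (u, r) j = v then h (g0AC blk q (u', r')) else 0) := by
    intro u u'
    rw [← Fintype.sum_prod_type', ← Fintype.sum_prod_type']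
    set S : Set B := {b | ∃ i i', j ≤ i ∧ i < i' ∧ q u i' = b ∧ q u' i = b} with hS
    rw [← Equiv.sum_comp (phiAC blk σ hσ S)
      (fun p => if g0AC blk q (u, p.1) j = v then h (g0AC blk q (u', p.2)) else 0)]
    refine Finset.sum_congr rfl ?_
    rintro ⟨r, r'⟩ _
    have h0 : q u j ∉ S := by
      rintro ⟨i, i', h1, h2, h3, h4⟩
      have := hq u h3
      subst this
      exact absurd (lt_of_le_of_lt h1 h2) (lt_irrefl _)
    have h1 : g0AC blk q (u, ((phiAC blk σ hσ S) (r, r')).1) j = g0AC blk q (u, r) j := by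
      simp [g0AC, phiAC, h0]
    have h2 : h (gAC blk σ q (g0AC blk q (u, r)) (u', r')) =
        h (g0AC blk q (u', ((phiAC blk σ hσ S) (r, r')).2)) := by
      apply hh
      intro i hi
      by_cases hb : q u' i ∈ S
      · obtain ⟨i1, i', a1, a2, a3, a4⟩ := id hb
        have := hq u' a4
        subst this
        have e1 : g0AC blk q (u', ((phiAC blk σ hσ S) (r, r')).2) i1 = σ (r (q u' i1)) := by
          simp [g0AC, phiAC, hb, sigAC]
        rw [e1]
        refine selAC_of_unique σ _ _ _ ⟨(r _).2, i', a2, ?_⟩ ?_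
        · exact valAC_congr blk r a3
        · rintro w' ⟨b1, i2, b2, b3⟩
          simp only [g0AC] at b3 b1
          have b4 : q u i2 = q u' i1 := by rw [← b1, ← b3]; exact (r _).2.symm
          rw [← b3, b4]
      · have e1 : g0AC blk q (u', ((phiAC blk σ hσ S) (r, r')).2) i = r' (q u' i) := by
          simp [g0AC, phiAC, hb]
        rw [e1]
        refine selAC_of_not σ _ _ ?_
        rintro ⟨w', b1, i2, b2, b3⟩
        simp only [g0AC] at b3 b1
        have b4 : q u i2 = q u' i := by rw [← b1, ← b3]; exact (r _).2.symm
        exact hb ⟨i, i2, hi, b2, b4, rfl⟩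
    simp only [h1, h2]
  have conv : ∀ F : V × RAC blk → V × RAC blk → ENNReal,
      ∑ e0, (if g0AC blk q e0 j = v then ∑ e, F e0 e else 0) =
      ∑ u : V, ∑ u' : V, ∑ r : RAC blk, ∑ r' : RAC blk,
        (if g0AC blk q (u, r) j = v then F (u, r) (u', r') else 0) := by
    intro F
    rw [Fintype.sum_prod_type]
    refine Finset.sum_congr rfl fun u _ => ?_
    rw [Finset.sum_comm]
    refine Finset.sum_congr rfl fun r _ => ?_
    split_ifs with hc
    · rw [Fintype.sum_prod_type]
    · simp
  rw [conv (fun e0 e => h (gAC blk σ q (g0AC blk q e0) e)), conv (fun _ e => h (g0AC blk q e))]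
  exact Finset.sum_congr rfl fun u _ => Finset.sum_congr rfl fun u' _ => main u u'

lemma card_g0AC (τ : Fin k → Equiv.Perm V) (hτ : ∀ u i, q u i = blk (τ i u)) (j : Fin k) (v : V) :
    (Finset.univ.filter (fun e : V × RAC blk => g0AC blk q e j = v)).card =
      Fintype.card (RAC blk) := by
  have h : (Finset.univ.filter (fun e : V × RAC blk => g0AC blk q e j = v)).card =
      (({v} : Finset V) ×ˢ (Finset.univ : Finset (RAC blk))).card := by
    refine Finset.card_bij'
      (fun e _ => ((e.2 (q e.1 j) : V), Function.update e.2 (q e.1 j) ⟨τ j e.1, (hτ _ _).symm⟩))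
      (fun e _ => ((τ j).symm (e.2 (blk e.1)), Function.update e.2 (blk e.1) ⟨e.1, rfl⟩)) ?_ ?_ ?_ ?_
    · intro e he
      rw [Finset.mem_filter] at he
      simpa [g0AC] using he.2.symm
    · rintro ⟨u, r⟩ he
      have hu : u = v := by simpa [eq_comm] using he
      subst hu
      have h1 : blk u = q ((τ j).symm (r (blk u))) j := by
        rw [hτ, Equiv.apply_symm_apply]; exact (r _).2.symm
      rw [Finset.mem_filter]
      refine ⟨Finset.mem_univ _, ?_⟩
      have := valAC_congr blk (Function.update r (blk u) ⟨u, rfl⟩) h1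
      simp only [Function.update_self] at this
      exact this.symm
    · rintro ⟨u, r⟩ he
      have h1 : blk (r (q u j) : V) = q u j := (r _).2
      have h2 := updAC_val blk r (q u j) _ h1 (τ j u) (hτ _ _).symm
      have h3 := updAC_upd blk r (q u j) _ h1 (τ j u) (hτ _ _).symm
      refine Prod.ext ?_ ?_
      · simp only [h2, Equiv.symm_apply_apply]
      · refine h3.trans ?_
        exact Function.update_eq_self _ _
    · rintro ⟨u, r⟩ he
      have h1 : q ((τ j).symm (r (blk u))) j = blk u := by
        rw [hτ, Equiv.apply_symm_apply]; exact (r _).2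
      have h2 := valAC_congr blk (Function.update r (blk u) ⟨u, rfl⟩) h1
      simp only [Function.update_self] at h2
      refine Prod.ext h2 ?_
      funext b
      refine Subtype.ext ?_
      by_cases hb : b = q ((τ j).symm (r (blk u))) j
      · subst hb
        simp only [Function.update_self, Equiv.apply_symm_apply]
        exact valAC_congr blk r h1.symm
      · simp only [Function.update_of_ne hb]
        rw [Function.update_of_ne (by rwa [← h1])]
  rw [h]; simp

lemma card_indepAC (b0 : B) (P Q : RAC blk → Prop) [DecidablePred P] [DecidablePred Q]
    (hP : ∀ r r', (∀ b, b ≠ b0 → r b = r' b) → P r → P r')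
    (hQ : ∀ r r', r b0 = r' b0 → Q r → Q r') :
    (Finset.univ.filter (fun r => P r ∧ Q r)).card * Fintype.card (RAC blk) =
      (Finset.univ.filter P).card * (Finset.univ.filter Q).card := by
  rw [← Finset.card_univ, ← Finset.card_product, ← Finset.card_product]
  refine Finset.card_bij'
    (fun p _ => (Function.update p.1 b0 (p.2 b0), Function.update p.2 b0 (p.1 b0)))
    (fun p _ => (Function.update p.1 b0 (p.2 b0), Function.update p.2 b0 (p.1 b0))) ?_ ?_ ?_ ?_
  · rintro ⟨r, r'⟩ h
    simp only [Finset.mem_product, Finset.mem_filter, Finset.mem_univ, true_and, and_true] at h ⊢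
    exact ⟨hP r _ (fun b hb => by simp [hb]) h.1, hQ r _ (by simp) h.2⟩
  · rintro ⟨r, r'⟩ h
    simp only [Finset.mem_product, Finset.mem_filter, Finset.mem_univ, true_and, and_true] at h ⊢
    exact ⟨hP r _ (fun b hb => by simp [hb]) h.1, hQ r' _ (by simp) h.2⟩
  · rintro ⟨r, r'⟩ h; simp
  · rintro ⟨r, r'⟩ h; simp

open Classical in
include hσ in
lemma static_markov (hq : ∀ u, Function.Injective (q u)) (j : Fin k) (x y : Fin k → V) (w : V) :
    (Finset.univ.filter (fun e : V × RAC blk =>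
      (∀ i < j, gAC blk σ q x e i = y i) ∧ gAC blk σ q x e j = w)).card *
    (Finset.univ.filter (fun e : V × RAC blk => ∀ i < j, q e.1 i = blk (y i))).card =
    (Finset.univ.filter (fun e : V × RAC blk => ∀ i < j, gAC blk σ q x e i = y i)).card *
    (Finset.univ.filter (fun e : V × RAC blk =>
      (∀ i < j, q e.1 i = blk (y i)) ∧ gAC blk σ q x e j = w)).card := by
  set Dr : RAC blk → Prop := fun r =>
    ∀ i < j, selAC σ (parAC blk x i (blk (y i))) (r (blk (y i))) = y i with hDr
  set U : Finset V := Finset.univ.filter (fun u => ∀ i < j, q u i = blk (y i)) with hU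
  have slice : ∀ (P : V × RAC blk → Prop) [DecidablePred P], (∀ e, P e → e.1 ∈ U) →
      (Finset.univ.filter P).card = ∑ u ∈ U, (Finset.univ.filter (fun r => P (u, r))).card := by
    intro P _ hP
    simp only [Finset.card_filter]
    rw [Fintype.sum_prod_type]
    refine (Finset.sum_subset (Finset.subset_univ U) ?_).symm
    intro u _ hu
    refine Finset.sum_eq_zero fun r _ => if_neg fun h => hu (hP _ h)
  have hD : ∀ u r, u ∈ U → ((∀ i < j, gAC blk σ q x (u, r) i = y i) ↔ Dr r) := by
    intro u r hu
    have hu' : ∀ i < j, q u i = blk (y i) := by simpa [hU] using hu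
    refine forall_congr' fun i => forall_congr' fun hi => ?_
    simp only [gAC, hu' i hi, valAC_congr blk r (hu' i hi)]
  have hDU : ∀ e : V × RAC blk, (∀ i < j, gAC blk σ q x e i = y i) → e.1 ∈ U := by
    intro e he
    simp only [hU, Finset.mem_filter, Finset.mem_univ, true_and]
    intro i hi
    rw [← he i hi, blk_gAC blk σ hσ]
  have hCU : ∀ e : V × RAC blk, (∀ i < j, q e.1 i = blk (y i)) → e.1 ∈ U := by
    intro e he
    simpa [hU] using he
  rw [slice _ (fun e he => hDU e he.1), slice _ hCU, slice _ hDU, slice _ (fun e he => hCU e he.1)]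
  have e1 : ∀ u ∈ U, (Finset.univ.filter (fun r : RAC blk =>
      (∀ i < j, gAC blk σ q x (u, r) i = y i) ∧ gAC blk σ q x (u, r) j = w)).card *
      Fintype.card (RAC blk) = (Finset.univ.filter Dr).card *
        (Finset.univ.filter (fun r : RAC blk => gAC blk σ q x (u, r) j = w)).card := by
    intro u hu
    have hu' : ∀ i < j, q u i = blk (y i) := by simpa [hU] using hu
    rw [← card_indepAC blk (q u j)]
    · congr 2
      ext r
      simp only [Finset.mem_filter, Finset.mem_univ, true_and]
      rw [hD u r hu]
    · intro r r' h hr i hi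
      have hne : blk (y i) ≠ q u j := by
        rw [← hu' i hi]
        exact fun hc => absurd (hq u hc) hi.ne
      have h2 := hr i hi
      rw [h _ hne] at h2
      exact h2
    · intro r r' h hr
      simp only [gAC] at hr ⊢
      rw [← h]; exact hr
  have e2 : ∀ u ∈ U, (Finset.univ.filter (fun r : RAC blk => ∀ i < j, q u i = blk (y i))).card =
      Fintype.card (RAC blk) := by
    intro u hu
    have hu' : ∀ i < j, q u i = blk (y i) := by simpa [hU] using hu
    rw [Finset.filter_true_of_mem (fun r _ => hu')]; rfl
  have e3 : ∀ u ∈ U, (Finset.univ.filter (fun r : RAC blk =>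
      ∀ i < j, gAC blk σ q x (u, r) i = y i)).card = (Finset.univ.filter Dr).card := by
    intro u hu
    congr 1
    ext r
    simp only [Finset.mem_filter, Finset.mem_univ, true_and]
    rw [hD u r hu]
  have e4 : ∀ u ∈ U, (Finset.univ.filter (fun r : RAC blk =>
      (∀ i < j, q u i = blk (y i)) ∧ gAC blk σ q x (u, r) j = w)).card =
      (Finset.univ.filter (fun r : RAC blk => gAC blk σ q x (u, r) j = w)).card := by
    intro u hu
    have hu' : ∀ i < j, q u i = blk (y i) := by simpa [hU] using hu
    congr 1
    ext r
    simp only [Finset.mem_filter, Finset.mem_univ, true_and]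
    exact and_iff_right hu'
  rw [Finset.sum_congr rfl e2, Finset.sum_congr rfl e3, Finset.sum_congr rfl e4]
  simp only [Finset.sum_const, smul_eq_mul]
  rw [mul_left_comm, Finset.sum_mul, Finset.sum_congr rfl e1, ← Finset.mul_sum, mul_assoc]

open Classical in
/-- The transition rule of walker `j`. -/
noncomputable def fAC (j : Fin k) (c : Fin k → V) : PMF V :=
  if h : (Finset.univ.filter (fun e : V × RAC blk => ∀ i < j, q e.1 i = blk (c i))).Nonempty then
    PMF.map (fun e => gAC blk σ q c e j) (PMF.uniformOfFinset _ h)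
  else PMF.pure (c j)

open Classical in
lemma fAC_apply (j : Fin k) (c : Fin k → V) (w : V)
    (h : (Finset.univ.filter (fun e : V × RAC blk => ∀ i < j, q e.1 i = blk (c i))).Nonempty) :
    fAC blk σ q j c w =
    ((Finset.univ.filter (fun e : V × RAC blk =>
      (∀ i < j, q e.1 i = blk (c i)) ∧ gAC blk σ q c e j = w)).card : ENNReal) *
    ((Finset.univ.filter (fun e : V × RAC blk => ∀ i < j, q e.1 i = blk (c i))).card : ENNReal)⁻¹ := by
  rw [fAC, dif_pos h, PMF.map_apply, tsum_fintype]
  simp only [PMF.uniformOfFinset_apply]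
  generalize ((Finset.univ.filter (fun e : V × RAC blk =>
    ∀ i < j, q e.1 i = blk (c i))).card : ENNReal)⁻¹ = N
  rw [Finset.card_filter, Nat.cast_sum, Finset.sum_mul]
  refine Finset.sum_congr rfl fun e _ => ?_
  simp only [Finset.mem_filter, Finset.mem_univ, true_and]
  by_cases h1 : w = gAC blk σ q c e j <;> by_cases h2 : ∀ i < j, q e.1 i = blk (c i) <;>
    simp [h1, h2, eq_comm]

end static

/-! ### Part 3: the coupling -/

lemma nuAC_apply {E : Type} [Fintype E] [MeasurableSpace E] [MeasurableSingletonClass E]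
    (P : E → Prop) [DecidablePred P] :
    uniformOn (Set.univ : Set E) {e | P e} =
      ((Finset.univ.filter P).card : ENNReal) * (Fintype.card E : ENNReal)⁻¹ := by
  rw [uniformOn_univ, div_eq_mul_inv]
  congr 1
  rw [← Measure.count_apply_finset]
  congr 1
  ext e; simp

lemma nuAC_sum {E C : Type} [Fintype E] [MeasurableSpace E] [MeasurableSingletonClass E]
    [Fintype C] [DecidableEq C] (f : E → C) (h : C → ENNReal) :
    ∑ y, uniformOn (Set.univ : Set E) {e | f e = y} * h y =
      (∑ e, h (f e)) * (Fintype.card E : ENNReal)⁻¹ := by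
  simp_rw [nuAC_apply, Finset.card_filter, Nat.cast_sum, Finset.sum_mul]
  rw [Finset.sum_comm]
  refine Finset.sum_congr rfl fun e _ => ?_
  rw [Finset.sum_eq_single (f e)]
  · simp [mul_comm]
  · intro y _ hy; simp [hy.symm]
  · simp

section final
variable {B : Type} [Fintype B] [DecidableEq B] {n k : ℕ}
variable (blk : Fin n → B) (σ : Equiv.Perm (Fin n)) (hσ : ∀ v, blk (σ v) = blk v)
  (q : Fin n → Fin k → B)

include hσ in
lemma faithful_sum_AC [Nonempty (Fin n × RAC blk)]
    (hq : ∀ u, Function.Injective (q u)) (τ : Fin k → Equiv.Perm (Fin n))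
    (hτ : ∀ u i, q u i = blk (τ i u)) (j : Fin k) (v : ℕ → Fin n) (t : ℕ) :
    ∀ h : (Fin k → Fin n) → ENNReal, (∀ x x', (∀ i, j ≤ i → x i = x' i) → h x = h x') →
    ∑ x, Measure.infinitePi (fun _ : ℕ => uniformOn (Set.univ : Set (Fin n × RAC blk)))
      ({ω | ∀ s < t, trajAC (g0AC blk q) (gAC blk σ q) ω s j = v s} ∩
        {ω | trajAC (g0AC blk q) (gAC blk σ q) ω t = x}) * h x =
    ((n : ENNReal)⁻¹) ^ t *
      ((∑ e, h (g0AC blk q e)) * (Fintype.card (Fin n × RAC blk) : ENNReal)⁻¹) := by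
  have hcE : (Fintype.card (Fin n × RAC blk) : ENNReal) = n * Fintype.card (RAC blk) := by
    rw [Fintype.card_prod, Fintype.card_fin, Nat.cast_mul]
  have hcR : (Fintype.card (RAC blk) : ENNReal) ≠ 0 := by
    have : Nonempty (RAC blk) := ⟨(Classical.arbitrary (Fin n × RAC blk)).2⟩
    exact_mod_cast Fintype.card_ne_zero
  have hcc : (Fintype.card (RAC blk) : ENNReal) *
      (Fintype.card (Fin n × RAC blk) : ENNReal)⁻¹ = (n : ENNReal)⁻¹ := by
    rw [hcE, ENNReal.mul_inv (Or.inr (ENNReal.natCast_ne_top _)) (Or.inr hcR), mul_left_comm,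
      ENNReal.mul_inv_cancel hcR (ENNReal.natCast_ne_top _), mul_one]
  induction t with
  | zero =>
    intro h _
    rw [pow_zero, one_mul, ← nuAC_sum]
    refine Finset.sum_congr rfl fun x _ => ?_
    congr 1
    rw [← (measurePreserving_eval_infinitePi (fun _ : ℕ =>
      uniformOn (Set.univ : Set (Fin n × RAC blk))) 0).measure_preimage
        (Set.toFinite _).measurableSet.nullMeasurableSet]
    congr 1
    ext ω
    simp [trajAC]
  | succ t ih =>
    intro h hh
    set c : ENNReal := (Fintype.card (Fin n × RAC blk) : ENNReal)⁻¹ with hc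
    have hdep0 : DepAC t {ω : ℕ → Fin n × RAC blk |
        ∀ s < t, trajAC (g0AC blk q) (gAC blk σ q) ω s j = v s} := by
      intro ω ω' hω h1 s hs
      rw [← trajAC_congr _ _ ω ω' s (fun r hr => hω r (by omega))]
      exact h1 s hs
    have hset : {ω : ℕ → Fin n × RAC blk |
        ∀ s < t + 1, trajAC (g0AC blk q) (gAC blk σ q) ω s j = v s} =
        {ω | ∀ s < t, trajAC (g0AC blk q) (gAC blk σ q) ω s j = v s} ∩
        {ω | trajAC (g0AC blk q) (gAC blk σ q) ω t j = v t} := by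
      ext ω
      simp only [Set.mem_inter_iff, Set.mem_ofPred_eq, Nat.lt_succ_iff_lt_or_eq, or_imp,
        forall_and, forall_eq]
    rw [hset, markov_sum_AC _ (g0AC blk q) (gAC blk σ q) t _ (depAC_inter hdep0 (depAC_traj (g0AC blk q) (gAC blk σ q) t (fun x : Fin k → Fin n => x j = v t)))]
    simp_rw [nuAC_sum]
    have ih' := ih (fun x => if x j = v t then (∑ e, h (gAC blk σ q x e)) * c else 0) (by
      intro x x' hx
      have : ∀ e, h (gAC blk σ q x e) = h (gAC blk σ q x' e) := fun e =>
        hh _ _ fun i hi => gAC_congr blk σ q x x' i (fun i' hi' => hx i' (hi.trans hi'.le)) e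
      simp only [this, hx j le_rfl])
    refine Eq.trans ?_ (ih'.trans ?_)
    · refine Finset.sum_congr rfl fun x _ => ?_
      by_cases hx : x j = v t
      · rw [if_pos hx]
        congr 2
        ext ω
        simp only [Set.mem_inter_iff, Set.mem_ofPred_eq]
        constructor
        · rintro ⟨⟨a, _⟩, b⟩; exact ⟨a, b⟩
        · rintro ⟨a, b⟩; exact ⟨⟨a, by rw [b]; exact hx⟩, b⟩
      · rw [if_neg hx, mul_zero]
        refine mul_eq_zero.2 (Or.inl (measure_mono_null (t := ∅) ?_ measure_empty))
        intro ω
        simp only [Set.mem_inter_iff, Set.mem_ofPred_eq, Set.mem_empty_iff_false, imp_false]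
        rintro ⟨⟨_, a⟩, b⟩
        exact hx (by rw [← b]; exact a)
    · have e1 : ∑ e0, (if g0AC blk q e0 j = v t then
          (∑ e, h (gAC blk σ q (g0AC blk q e0) e)) * c else 0) =
          (Fintype.card (RAC blk) : ENNReal) * (∑ e, h (g0AC blk q e)) * c := by
        have := static_round blk σ hσ q hq j (v t) h hh
        simp_rw [← ite_zero_mul]
        rw [← Finset.sum_mul, this, ← card_g0AC blk q τ hτ j (v t), Finset.card_filter,
          Nat.cast_sum]
        congr 1
        rw [Finset.sum_mul]
        refine Finset.sum_congr rfl fun e _ => ?_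
        split_ifs <;> simp
      rw [e1, pow_succ, ← hcc]
      ring

include hσ in
lemma faithful_AC [Nonempty (Fin n × RAC blk)]
    (hq : ∀ u, Function.Injective (q u)) (τ : Fin k → Equiv.Perm (Fin n))
    (hτ : ∀ u i, q u i = blk (τ i u)) (j : Fin k) (v : ℕ → Fin n) (t : ℕ) :
    Measure.infinitePi (fun _ : ℕ => uniformOn (Set.univ : Set (Fin n × RAC blk)))
      {ω | ∀ s < t, trajAC (g0AC blk q) (gAC blk σ q) ω s j = v s} = ((n : ENNReal)⁻¹) ^ t := by
  have h1 := faithful_sum_AC blk σ hσ q hq τ hτ j v t (fun _ => 1) (fun _ _ _ => rfl)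
  simp only [mul_one] at h1
  have hdep0 : DepAC t {ω : ℕ → Fin n × RAC blk |
      ∀ s < t, trajAC (g0AC blk q) (gAC blk σ q) ω s j = v s} := by
    intro ω ω' hω h1 s hs
    rw [← trajAC_congr _ _ ω ω' s (fun r hr => hω r (by omega))]
    exact h1 s hs
  rw [measure_partition_AC _ (g0AC blk q) (gAC blk σ q) t _ hdep0.measurableSet, h1]
  rw [Finset.sum_const, Finset.card_univ, nsmul_eq_mul, mul_one, ENNReal.mul_inv_cancel, mul_one]
  · exact_mod_cast Fintype.card_ne_zero
  · exact ENNReal.natCast_ne_top _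

include hσ in
lemma blk_trajAC (ω : ℕ → Fin n × RAC blk) (t : ℕ) (i : Fin k) :
    blk (trajAC (g0AC blk q) (gAC blk σ q) ω t i) = q (ω t).1 i := by
  cases t with
  | zero => exact blk_g0AC blk q _ _
  | succ t => exact blk_gAC blk σ hσ q _ _ _

open Classical in
include hσ in
lemma coupling_AC (hfix : ∀ v, σ v ≠ v) (hne : Nonempty (Fin n × RAC blk))
    (hq : ∀ u, Function.Injective (q u)) (τ : Fin k → Equiv.Perm (Fin n))
    (hτ : ∀ u i, q u i = blk (τ i u)) : MarkovianAvoidanceCouplingLooped n k := by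
  haveI : IsProbabilityMeasure (uniformOn (Set.univ : Set (Fin n × RAC blk))) :=
    isProbabilityMeasure_uniformOn Set.finite_univ Set.univ_nonempty
  refine ⟨ℕ → Fin n × RAC blk, inferInstance,
    Measure.infinitePi (fun _ : ℕ => uniformOn (Set.univ : Set (Fin n × RAC blk))),
    fun j t ω => trajAC (g0AC blk q) (gAC blk σ q) ω t j, inferInstance, ?_, ?_, ?_, ?_⟩
  · intro j t
    refine measurable_to_countable' fun v => ?_
    exact (depAC_traj (g0AC blk q) (gAC blk σ q) t (fun x => x j = v)).measurableSet
  · intro j t v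
    have h1 := faithful_AC blk σ hσ q hq τ hτ j v (t + 1)
    have h2 := faithful_AC blk σ hσ q hq τ hτ j v (t + 1 + 1)
    simp only [Nat.lt_succ_iff] at h1 h2
    rw [h1, h2, pow_succ]
  · refine Filter.Eventually.of_forall fun ω => ⟨?_, ?_⟩
    · intro i j hij h
      have := congrArg blk h
      rw [blk_trajAC blk σ hσ, blk_trajAC blk σ hσ] at this
      exact hij (hq _ this)
    · intro t i j
      refine ⟨?_, ?_⟩
      · intro hij h
        have := congrArg blk h
        rw [blk_trajAC blk σ hσ, blk_trajAC blk σ hσ] at this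
        exact hij.ne' (hq _ this)
      · intro hij h
        have hb := congrArg blk h
        rw [blk_trajAC blk σ hσ] at hb
        have h3 : trajAC (g0AC blk q) (gAC blk σ q) ω (t + 1) j =
            σ (trajAC (g0AC blk q) (gAC blk σ q) ω t i) := by
          refine selAC_of_unique σ _ _ _ ⟨hb.symm, i, hij, rfl⟩ ?_
          rintro w ⟨b1, i', b2, rfl⟩
          rw [hb, blk_trajAC blk σ hσ, blk_trajAC blk σ hσ] at b1
          rw [hq _ b1]
        exact hfix _ (h3.symm.trans h)
  · refine ⟨fAC blk σ q, ?_⟩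
    intro t j v w
    set μ := Measure.infinitePi (fun _ : ℕ => uniformOn (Set.univ : Set (Fin n × RAC blk)))
    set A : Set (ℕ → Fin n × RAC blk) :=
      {ω | ∀ i : Fin k, ∀ s ≤ t, trajAC (g0AC blk q) (gAC blk σ q) ω s i = v i s} with hA
    set x : Fin k → Fin n := fun i => v i t with hx
    set y : Fin k → Fin n := fun i => v i (t + 1) with hy
    have hdep : DepAC t A := by
      intro ω ω' hω h1 i s hs
      rw [← trajAC_congr _ _ ω ω' s (fun r hr => hω r (by omega))]
      exact h1 i s hs
    have hstep : ∀ ω ∈ A, trajAC (g0AC blk q) (gAC blk σ q) ω (t + 1) =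
        gAC blk σ q x (ω (t + 1)) := by
      intro ω hω
      have : trajAC (g0AC blk q) (gAC blk σ q) ω t = x := funext fun i => hω i t le_rfl
      rw [← this]; rfl
    have s1 : {ω : ℕ → Fin n × RAC blk |
        ((∀ i : Fin k, ∀ s ≤ t, trajAC (g0AC blk q) (gAC blk σ q) ω s i = v i s) ∧
        (∀ i < j, trajAC (g0AC blk q) (gAC blk σ q) ω (t + 1) i = v i (t + 1))) ∧
        trajAC (g0AC blk q) (gAC blk σ q) ω (t + 1) j = w} =
        A ∩ {ω | ω (t + 1) ∈ {e | (∀ i < j, gAC blk σ q x e i = y i) ∧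
          gAC blk σ q x e j = w}} := by
      ext ω
      simp only [Set.mem_inter_iff, Set.mem_ofPred_eq, and_assoc]
      refine and_congr_right fun hω => ?_
      rw [hstep ω hω]
    have s2 : {ω : ℕ → Fin n × RAC blk |
        (∀ i : Fin k, ∀ s ≤ t, trajAC (g0AC blk q) (gAC blk σ q) ω s i = v i s) ∧
        (∀ i < j, trajAC (g0AC blk q) (gAC blk σ q) ω (t + 1) i = v i (t + 1))} =
        A ∩ {ω | ω (t + 1) ∈ {e | ∀ i < j, gAC blk σ q x e i = y i}} := by
      ext ω
      simp only [Set.mem_inter_iff, Set.mem_ofPred_eq]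
      refine and_congr_right fun hω => ?_
      rw [hstep ω hω]
    rw [s1, s2, hdep.indep (uniformOn Set.univ), hdep.indep (uniformOn Set.univ), mul_assoc, nuAC_apply, nuAC_apply]
    congr 1
    set z : Fin k → Fin n := fun i => if i < j then v i (t + 1) else v i t with hz
    have hzy : ∀ i < j, z i = y i := fun i hi => by simp [hz, hy, hi]
    have hzx : ∀ e, gAC blk σ q z e j = gAC blk σ q x e j := fun e =>
      gAC_congr blk σ q z x j (fun i hi => by simp [hz, hx, hi.le]) e
    have key := static_markov blk σ hσ q hq j x y w
    have c1 : (Finset.univ.filter (fun e : Fin n × RAC blk => ∀ i < j, q e.1 i = blk (z i))) =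
        Finset.univ.filter (fun e : Fin n × RAC blk => ∀ i < j, q e.1 i = blk (y i)) := by
      ext e
      simp only [Finset.mem_filter, Finset.mem_univ, true_and]
      exact forall_congr' fun i => forall_congr' fun hi => by rw [hzy i hi]
    have c2 : (Finset.univ.filter (fun e : Fin n × RAC blk =>
        (∀ i < j, q e.1 i = blk (z i)) ∧ gAC blk σ q z e j = w)) =
        Finset.univ.filter (fun e : Fin n × RAC blk =>
        (∀ i < j, q e.1 i = blk (y i)) ∧ gAC blk σ q x e j = w) := by
      ext e
      simp only [Finset.mem_filter, Finset.mem_univ, true_and, hzx]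
      exact and_congr_left fun _ => forall_congr' fun i => forall_congr' fun hi => by rw [hzy i hi]
    by_cases hC : (Finset.univ.filter (fun e : Fin n × RAC blk =>
        ∀ i < j, q e.1 i = blk (z i))).Nonempty
    · rw [fAC_apply blk σ q j z w hC, c1, c2]
      rw [c1] at hC
      have hN : ((Finset.univ.filter (fun e : Fin n × RAC blk =>
          ∀ i < j, q e.1 i = blk (y i))).card : ENNReal) ≠ 0 := by
        exact_mod_cast hC.card_pos.ne'
      have key' := congrArg (Nat.cast : ℕ → ENNReal) key
      rw [Nat.cast_mul, Nat.cast_mul] at key'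
      have key2 := (ENNReal.eq_div_iff hN (ENNReal.natCast_ne_top _)).2 ((mul_comm _ _).trans key')
      rw [key2, div_eq_mul_inv]
      ring
    · have hE : ∀ (P : Fin n × RAC blk → Prop) [DecidablePred P], (∀ e, P e → ∀ i < j, gAC blk σ q x e i = y i) →
          (Finset.univ.filter P) = ∅ := by
        intro P _ hP
        rw [Finset.filter_eq_empty_iff]
        intro e _ he
        refine hC ⟨e, ?_⟩
        rw [c1]
        simp only [Finset.mem_filter, Finset.mem_univ, true_and]
        intro i hi
        rw [← hP e he i hi, blk_gAC blk σ hσ]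
      rw [@hE (fun e => (∀ i < j, gAC blk σ q x e i = y i) ∧ gAC blk σ q x e j = w) _
        (fun e he => he.1), @hE (fun e => (∀ i < j, gAC blk σ q x e i = y i)) _ (fun e he => he)]
      simp

end final

lemma exists_perm_AC {α : Type} [Fintype α] [Nontrivial α] : ∃ s : Equiv.Perm α, ∀ a, s a ≠ a := by
  obtain ⟨m, hm⟩ : ∃ m, Fintype.card α = m + 2 :=
    ⟨Fintype.card α - 2, by have := Fintype.one_lt_card (α := α); omega⟩
  let e := Fintype.equivFinOfCardEq hm
  refine ⟨e.trans ((finRotate (m + 2)).trans e.symm), fun a h => ?_⟩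
  have h1 : finRotate (m + 2) (e a) = e a := by
    have := congrArg e h
    simpa using this
  rw [finRotate_apply] at h1
  simp at h1

theorem markovian_avoidance_coupling_looped_general (n k : ℕ)
    (hn : 2 ≤ n) (hk : 1 ≤ k)
    (hkn : (k : ℝ) ≤ (n : ℝ) / (8 * Real.logb 2 (n : ℝ))) :
    MarkovianAvoidanceCouplingLooped n k := by
  have h3 : 3 * k ≤ n := by
    have hn' : (2 : ℝ) ≤ n := by exact_mod_cast hn
    have hlog : 1 ≤ Real.logb 2 (n : ℝ) := by
      rw [Real.le_logb_iff_rpow_le (by norm_num) (by linarith)]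
      simpa using hn'
    have : (k : ℝ) * (8 * Real.logb 2 (n : ℝ)) ≤ n := (le_div_iff₀ (by positivity)).1 hkn
    have hk0 : (0 : ℝ) ≤ k := Nat.cast_nonneg k
    have : (3 * k : ℝ) ≤ n := by nlinarith
    exact_mod_cast this
  haveI : NeZero n := ⟨by omega⟩
  let blk : Fin n → Fin (n / 2) := fun v => ⟨min (v.1 / 2) (n / 2 - 1), by omega⟩
  have hfib : ∀ b : Fin (n / 2), Nontrivial {v : Fin n // blk v = b} := by
    intro b
    refine ⟨⟨⟨⟨2 * b.1, by omega⟩, Fin.ext ?_⟩, ⟨⟨2 * b.1 + 1, by omega⟩, Fin.ext ?_⟩, ?_⟩⟩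
    · simp only [blk]; omega
    · simp only [blk]; omega
    · simp [Subtype.ext_iff, Fin.ext_iff]
  choose s hs using fun b : Fin (n / 2) =>
    (haveI := hfib b; exists_perm_AC (α := {v : Fin n // blk v = b}))
  let σ : Equiv.Perm (Fin n) := (Equiv.sigmaFiberEquiv blk).symm.trans
    ((Equiv.sigmaCongrRight s).trans (Equiv.sigmaFiberEquiv blk))
  have hσ : ∀ v, σ v = s (blk v) ⟨v, rfl⟩ := fun v => rfl
  let τ : Fin k → Equiv.Perm (Fin n) := fun i => Equiv.addRight (Fin.ofNat n (3 * i.1))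
  refine coupling_AC blk σ (fun v => ?_) (fun u i => blk (τ i u)) (fun v => ?_) ?_ ?_ τ
    (fun _ _ => rfl)
  · rw [hσ]; exact (s (blk v) ⟨v, rfl⟩).2
  · rw [hσ]
    exact fun h => hs (blk v) ⟨v, rfl⟩ (Subtype.ext h)
  · haveI : ∀ b, Nonempty {v : Fin n // blk v = b} := fun b => (hfib b).to_nonempty
    infer_instance
  · intro u i i' h
    have h' := congrArg Fin.val h
    simp only [blk, τ, Equiv.coe_addRight, Fin.val_add, Fin.ofNat] at h'
    have hu := u.2
    have hi := i.2
    have hi' := i'.2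
    have key : ∀ a < k, (u.1 + 3 * a % n) % n = if u.1 + 3 * a < n then u.1 + 3 * a
        else u.1 + 3 * a - n := by
      intro a ha
      rw [Nat.mod_eq_of_lt (by omega : 3 * a < n)]
      split_ifs with hc
      · exact Nat.mod_eq_of_lt hc
      · rw [Nat.mod_eq_sub_mod (by omega), Nat.mod_eq_of_lt (by omega)]
    rw [key _ hi, key _ hi'] at h'
    refine Fin.ext ?_
    split_ifs at h' <;> omega
end
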